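/- arXiv:2206.00883 — 2 statements merged into one kernel-verified Lean document; each statement's English description precedes it below -/
import Mathlib

section
/- (Hardy's theorem for the Strichartz Fourier transform.) Let a, b > 0 with a < b, and let p_a denote the heat kernel of the sublaplacian, p_a(z,t) = (2π)^{−n−1} ∫_ℝ e^{−iλt} (λ/sinh(aλ))^n e^{−(λ/4)coth(aλ)|z|²} dλ. Suppose f ∈ L¹(ℍⁿ) satisfies, for some constant C > 0: (i) |f(z,t)| ≤ C p_a(z,t) for all (z,t) ∈ ℍⁿ, and (ii) |λ|^n ∫_{ℂⁿ} |f̂((λ,(2k+n)|λ|), z)|² dz ≤ C ((k+n−1)!/(k!(n−1)!)) e^{−2b(2k+n)|λ|} for all λ ≠ 0 and all k ∈ ℕ. Then f = 0 almost everywhere. -/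
open MeasureTheory Complex Real Filter

noncomputable section

/-- ℂⁿ with its Euclidean (Hilbert space) structure. -/
abbrev Cn (n : ℕ) := EuclideanSpace ℂ (Fin n)

instance (n : ℕ) : MeasurableSpace (Cn n) := borel _
instance (n : ℕ) : BorelSpace (Cn n) := ⟨rfl⟩
instance (n : ℕ) : InnerProductSpace ℝ (Cn n) := InnerProductSpace.rclikeToReal ℂ (Cn n)

/-- The Heisenberg group ℍⁿ = ℂⁿ × ℝ (as a measure space with Lebesgue/Haar measure). -/
abbrev Hn (n : ℕ) := Cn n × ℝ

/-- Im (z · w̄) = Im (∑ⱼ zⱼ conj wⱼ). -/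
def imZW {n : ℕ} (z w : Cn n) : ℝ := (∑ j, z j * (starRingEnd ℂ) (w j)).im

/-- The λ-twisted convolution F ∗_λ G (z) = ∫ F(z−w) G(w) e^{(i/2)λ Im(z·w̄)} dw. -/
def twConv (n : ℕ) (lam : ℝ) (F G : Cn n → ℂ) (z : Cn n) : ℂ :=
  ∫ w : Cn n, F (z - w) * G w * Complex.exp
    (Complex.I / 2 * (lam : ℂ) * ((imZW z w : ℝ) : ℂ))

/-- The inverse Fourier transform in the central variable, f^λ(z) = ∫ e^{iλt} f(z,t) dt. -/
def fLam (n : ℕ) (f : Hn n → ℂ) (lam : ℝ) (z : Cn n) : ℂ :=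
  ∫ t : ℝ, Complex.exp (Complex.I * (lam : ℂ) * (t : ℂ)) * f (z, t)

/-- The Laguerre polynomial of type m−1:
L_k^{m−1}(t) = ∑_{j=0}^k binom(k+m−1, k−j) (−t)^j / j!. -/
def lagPoly (m k : ℕ) (t : ℝ) : ℝ :=
  ∑ j ∈ Finset.range (k + 1), ((k + m - 1).choose (k - j) : ℝ) * (-t) ^ j / (Nat.factorial j)

/-- The Laguerre function φ_{k,λ}^{m−1}(z) = L_k^{m−1}(|λ||z|²/2) e^{−|λ||z|²/4} on ℂ^m. -/
def lagFun (m k : ℕ) (lam : ℝ) (z : Cn m) : ℝ :=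
  lagPoly m k (|lam| * ‖z‖ ^ 2 / 2) * Real.exp (-(|lam| * ‖z‖ ^ 2 / 4))

/-- The Strichartz Fourier transform f̂(a,z) = f^{−λ} ∗_{−λ} φ_{k,λ}(z)
at the point a = (λ, (2k+n)|λ|) of the ray R_k. -/
def stri (n : ℕ) (f : Hn n → ℂ) (k : ℕ) (lam : ℝ) (z : Cn n) : ℂ :=
  twConv n (-lam) (fLam n f (-lam)) (fun w => ((lagFun n k lam w : ℝ) : ℂ)) z

/-- The normalizing constant k!(n−1)!/(k+n−1)!. -/
def normC (n k : ℕ) : ℝ :=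
  (Nat.factorial k * Nat.factorial (n - 1) : ℝ) / (Nat.factorial (k + n - 1))

/-- The Bessel kernel J_{n−1}(s)/s^{n−1}, extended by its limiting value
1/(2^{n−1}(n−1)!) at s = 0, given by its power series. -/
def besselKer (n : ℕ) (s : ℝ) : ℝ :=
  ∑' m : ℕ, (-1 : ℝ) ^ m / (Nat.factorial m * Nat.factorial (m + n - 1)) *
    s ^ (2 * m) / 2 ^ (2 * m + n - 1)

/-- The Strichartz Fourier transform f̂((0,τ),z) on the limiting ray R_∞. -/
def striLim (n : ℕ) (f : Hn n → ℂ) (z : Cn n) (τ : ℝ) : ℂ :=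
  ((Nat.factorial (n - 1) * 2 ^ (n - 1) : ℝ) : ℂ) *
    ∫ w : Cn n, fLam n f 0 (z - w) * ((besselKer n (Real.sqrt τ * ‖w‖) : ℝ) : ℂ)

/-- The Heisenberg fan Ω ⊆ ℝ²: union of the rays R_k, k ∈ ℕ, and the limiting ray R_∞. -/
def fan (n : ℕ) : Set (ℝ × ℝ) :=
  {a | (∃ k : ℕ, a.1 ≠ 0 ∧ a.2 = (2 * k + n) * |a.1|) ∨ (a.1 = 0 ∧ 0 ≤ a.2)}

open scoped Classical in
/-- The index k of the ray R_k through a point of the fan (junk value otherwise). -/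
def fanK (n : ℕ) (a : ℝ × ℝ) : ℕ :=
  if h : ∃ k : ℕ, a.2 = (2 * k + n) * |a.1| then h.choose else 0

/-- The normalized Strichartz Fourier transform f̃(a,z), as a function of a ∈ Ω. -/
def striNorm (n : ℕ) (f : Hn n → ℂ) (z : Cn n) (a : ℝ × ℝ) : ℂ :=
  if a.1 = 0 then striLim n f z a.2
  else ((normC n (fanK n a) : ℝ) : ℂ) * stri n f (fanK n a) a.1 z

/-- The Plancherel measure ν on the Heisenberg fan:
∫ φ dν = (2π)^{−2n−1} ∫_ℝ (∑_k φ(λ,(2k+n)|λ|)) |λ|^{2n} dλ. -/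
def fanMeasure (n : ℕ) : Measure (ℝ × ℝ) :=
  (ENNReal.ofReal ((2 * π) ^ (2 * n + 1)))⁻¹ •
    Measure.sum (fun k : ℕ =>
      Measure.map (fun lam : ℝ => (lam, (2 * k + n) * |lam|))
        (volume.withDensity fun lam => ENNReal.ofReal (|lam| ^ (2 * n))))

/-- A function on ℍⁿ is radial if it is invariant under the action of the unitary group U(n). -/
def IsRadial (n : ℕ) (g : Hn n → ℂ) : Prop :=
  ∀ (U : Cn n ≃ₗᵢ[ℂ] Cn n) (x : Hn n), g (U x.1, x.2) = g x

/-- The k-th Laguerre coefficient R_k(λ, f) = (k!(n−1)!/(k+n−1)!) ∫ f^λ(w) φ_{k,λ}(w) dw. -/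
def lagCoef (n : ℕ) (k : ℕ) (lam : ℝ) (f : Hn n → ℂ) : ℂ :=
  ((normC n k : ℝ) : ℂ) * ∫ w : Cn n, fLam n f lam w * ((lagFun n k lam w : ℝ) : ℂ)

/-- The Gelfand (spherical Fourier) transform of a radial function on ℍ^m, evaluated at
(λ, (2j+m)|λ|). -/
def gelfand (m : ℕ) (h : Hn m → ℂ) (lam : ℝ) (j : ℕ) : ℂ :=
  ((normC m j : ℝ) : ℂ) *
    ∫ x : Hn m, h x * Complex.exp (Complex.I * (lam : ℂ) * (x.2 : ℂ)) *
      ((lagFun m j lam x.1 : ℝ) : ℂ)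

/-- The group convolution on ℍⁿ: f∗g(x) = ∫ f(x·y⁻¹) g(y) dy. -/
def hConv (n : ℕ) (f g : Hn n → ℂ) (x : Hn n) : ℂ :=
  ∫ y : Hn n, f (x.1 - y.1, x.2 - y.2 - imZW x.1 y.1 / 2) * g y

/-- P is a bigraded solid harmonic of degree (p,q) on ℂⁿ: P(z) = ∑_{|α|=p,|β|=q} c_{αβ} z^α z̄^β,
harmonic as a function on ℝ^{2n} (the harmonicity Δ P = 0 is expressed by the equivalent
algebraic condition on the coefficients). -/
def IsBigradedSolidHarmonic (n p q : ℕ) (P : Cn n → ℂ) : Prop :=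
  ∃ c : (Fin n → ℕ) → (Fin n → ℕ) → ℂ,
    (∀ z : Cn n, P z =
      ∑ α ∈ Finset.Nat.antidiagonalTuple n p, ∑ β ∈ Finset.Nat.antidiagonalTuple n q,
        c α β * (∏ j, z j ^ α j) * ∏ j, (starRingEnd ℂ) (z j) ^ β j) ∧
    (∀ γ δ : Fin n → ℕ,
      ∑ j : Fin n, (((γ j + 1) * (δ j + 1) : ℕ) : ℂ) *
        c (Function.update γ j (γ j + 1)) (Function.update δ j (δ j + 1)) = 0)

/-- The physicists' Hermite polynomial H_m(x) = (−1)^m e^{x²} (d/dx)^m e^{−x²}. -/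
def physHermite (m : ℕ) (x : ℝ) : ℝ :=
  (-1 : ℝ) ^ m * Real.exp (x ^ 2) * iteratedDeriv m (fun y => Real.exp (-(y ^ 2))) x

/-- The normalized Hermite function h_m(x) = (2^m m! √π)^{−1/2} H_m(x) e^{−x²/2}. -/
def hermiteFun (m : ℕ) (x : ℝ) : ℝ :=
  (Real.sqrt (2 ^ m * (Nat.factorial m) * Real.sqrt π))⁻¹ * physHermite m x *
    Real.exp (-(x ^ 2) / 2)

/-- The scaled Hermite function Φ_α^λ(x) = |λ|^{n/4} ∏ⱼ h_{αⱼ}(√|λ| xⱼ). -/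
def scaledHermite (n : ℕ) (lam : ℝ) (α : Fin n → ℕ) (x : Fin n → ℝ) : ℝ :=
  |lam| ^ ((n : ℝ) / 4) * ∏ j, hermiteFun (α j) (Real.sqrt |lam| * x j)

/-- The Schrödinger representation: π_λ(z,t)φ(ξ) = e^{iλt} e^{iλ(x·ξ+(1/2)x·y)} φ(ξ+y),
z = x+iy. -/
def schrodinger (n : ℕ) (lam : ℝ) (zt : Hn n) (φ : (Fin n → ℝ) → ℂ) (ξ : Fin n → ℝ) : ℂ :=
  Complex.exp (Complex.I * (lam : ℂ) * (zt.2 : ℂ)) *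
    Complex.exp (Complex.I * (lam : ℂ) *
      (((∑ j, (zt.1 j).re * ξ j) + (∑ j, (zt.1 j).re * (zt.1 j).im) / 2 : ℝ) : ℂ)) *
    φ (fun j => ξ j + (zt.1 j).im)

/-- The group Fourier transform f̂(λ)φ = ∫ f(z,t) π_λ(z,t)φ dz dt. -/
def groupFT (n : ℕ) (f : Hn n → ℂ) (lam : ℝ) (φ : (Fin n → ℝ) → ℂ) (ξ : Fin n → ℝ) : ℂ :=
  ∫ x : Hn n, f x * schrodinger n lam x φ ξ


section GaussianIntegrals

variable {V : Type*} [NormedAddCommGroup V] [InnerProductSpace ℝ V] [FiniteDimensional ℝ V]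
  [MeasurableSpace V] [BorelSpace V]

lemma integrable_rexp_neg_mul_norm_sq {c : ℝ} (hc : 0 < c) :
    Integrable (fun v : V => Real.exp (-c * ‖v‖ ^ 2)) := by
  have h := (GaussianFourier.integrable_cexp_neg_mul_sq_norm_add (V := V) (b := (c : ℂ))
    (by simpa using hc) 0 0).norm
  refine h.congr (ae_of_all _ fun v => ?_)
  simp only [Complex.norm_exp]
  congr 1
  simp [← Complex.ofReal_pow]

lemma integrable_mul_cexp_norm_sq {K : V → ℂ} (hK : Continuous K) {M κ : ℝ}
    (hKM : ∀ w, ‖K w‖ ≤ M * Real.exp (-κ * ‖w‖ ^ 2)) {s : ℂ} (hs : -κ < s.re) :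
    Integrable (fun w => K w * Complex.exp (-s * ‖w‖ ^ 2)) := by
  refine ((integrable_rexp_neg_mul_norm_sq (V := V) (c := κ + s.re) (by linarith)).const_mul
    M).mono' (by fun_prop) (ae_of_all _ fun w => ?_)
  rw [norm_mul, Complex.norm_exp]
  calc _ ≤ (M * Real.exp (-κ * ‖w‖ ^ 2)) * Real.exp ((-s * (‖w‖ : ℂ) ^ 2).re) := by
        gcongr; exact hKM w
    _ = _ := by
        rw [mul_assoc, ← Real.exp_add, ← Complex.ofReal_pow, Complex.re_mul_ofReal]
        congr 2
        simp; ring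

lemma differentiableAt_integral_mul_cexp_norm_sq {K : V → ℂ} (hK : Continuous K) {M κ : ℝ}
    (hKM : ∀ w, ‖K w‖ ≤ M * Real.exp (-κ * ‖w‖ ^ 2)) {s : ℂ} (hs : -κ < s.re) :
    DifferentiableAt ℂ (fun s : ℂ => ∫ w, K w * Complex.exp (-s * ‖w‖ ^ 2)) s := by
  have hM : 0 ≤ M := by
    have := (norm_nonneg _).trans (hKM 0)
    simpa using this
  set ε := (s.re + κ) / 2 with hε
  have hε0 : 0 < ε := by rw [hε]; linarith
  refine (hasDerivAt_integral_of_dominated_loc_of_deriv_le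
    (F' := fun s w => K w * (Complex.exp (-s * ‖w‖ ^ 2) * (-1 * (‖w‖ : ℂ) ^ 2)))
    (bound := fun w => M * (2 / ε) * Real.exp (-(ε / 2) * ‖w‖ ^ 2))
    (Metric.ball_mem_nhds s hε0) (Eventually.of_forall fun s => by fun_prop)
    (integrable_mul_cexp_norm_sq hK hKM hs) (by fun_prop) (ae_of_all _ fun w x hx => ?_)
    ((integrable_rexp_neg_mul_norm_sq (by positivity)).const_mul _)
    (ae_of_all _ fun w x hx => ?_)).2.differentiableAt
  · have hx' : -κ + ε < x.re := by
      have h1 : |(x - s).re| < ε := (Complex.abs_re_le_norm _).trans_lt (by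
        simpa [dist_eq_norm] using hx)
      rw [Complex.sub_re, abs_lt] at h1
      linarith [h1.1]
    have hw : ‖w‖ ^ 2 ≤ (2 / ε) * Real.exp (ε / 2 * ‖w‖ ^ 2) := by
      have := Real.add_one_le_exp (ε / 2 * ‖w‖ ^ 2)
      calc ‖w‖ ^ 2 = (2 / ε) * (ε / 2 * ‖w‖ ^ 2) := by field_simp
        _ ≤ _ := by gcongr; linarith
    have he : ‖Complex.exp (-x * ‖w‖ ^ 2)‖ ≤ Real.exp ((κ - ε) * ‖w‖ ^ 2) := by
      rw [Complex.norm_exp, ← Complex.ofReal_pow, Complex.re_mul_ofReal]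
      gcongr
      simp; linarith
    calc ‖K w * (Complex.exp (-x * ‖w‖ ^ 2) * (-1 * (‖w‖ : ℂ) ^ 2))‖
        = ‖K w‖ * (‖Complex.exp (-x * ‖w‖ ^ 2)‖ * ‖w‖ ^ 2) := by simp
      _ ≤ (M * Real.exp (-κ * ‖w‖ ^ 2)) * (Real.exp ((κ - ε) * ‖w‖ ^ 2) *
          ((2 / ε) * Real.exp (ε / 2 * ‖w‖ ^ 2))) := by
          gcongr; exact hKM w
      _ = M * (2 / ε) * (Real.exp (-κ * ‖w‖ ^ 2) * Real.exp ((κ - ε) * ‖w‖ ^ 2) *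
          Real.exp (ε / 2 * ‖w‖ ^ 2)) := by ring
      _ = _ := by
          rw [← Real.exp_add, ← Real.exp_add]; congr 2; ring
  · have h : HasDerivAt (fun s : ℂ => -s * (‖w‖ : ℂ) ^ 2) (-1 * (‖w‖ : ℂ) ^ 2) x :=
      (hasDerivAt_neg x).mul_const _
    exact h.cexp.const_mul _

/-- Approximate identity: if all Gaussian means of `K` vanish then so does `K 0`. -/
lemma eq_zero_of_integral_mul_gaussian_eq_zero {K : V → ℂ} (hK : Continuous K)
    (hKi : Integrable K)
    (h : ∀ u : ℝ, 0 < u → ∫ w, K w * Complex.exp (-(u : ℂ) * ‖w‖ ^ 2) = 0) : K 0 = 0 := by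
  have hφ1 : ∫ v : V, Real.exp (-π * ‖v‖ ^ 2) = 1 := by
    rw [GaussianFourier.integral_rexp_neg_mul_sq_norm Real.pi_pos, div_self Real.pi_ne_zero,
      Real.one_rpow]
  have hdecay : Tendsto (fun x : V => ‖x‖ ^ Module.finrank ℝ V * Real.exp (-π * ‖x‖ ^ 2))
      (Bornology.cobounded V) (nhds 0) := by
    have h1 : Tendsto (fun t : ℝ => t ^ Module.finrank ℝ V * Real.exp (-π * t ^ 2)) atTop
        (nhds 0) := by
      have h2 := (tendsto_rpow_abs_mul_exp_neg_mul_sq_cocompact Real.pi_pos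
        (Module.finrank ℝ V : ℝ)).mono_left atTop_le_cocompact
      refine h2.congr' ?_
      filter_upwards [eventually_ge_atTop 0] with t ht
      rw [abs_of_nonneg ht, Real.rpow_natCast]
    exact h1.comp tendsto_norm_cobounded_atTop
  have key := tendsto_integral_comp_smul_smul_of_integrable (μ := (volume : Measure V))
    (fun x => (Real.exp_pos _).le) hφ1 hdecay hKi hK.continuousAt
  refine tendsto_nhds_unique key (tendsto_const_nhds.congr' ?_)
  filter_upwards [eventually_gt_atTop 0] with c hc
  have h3 := h (π * c ^ 2) (by positivity)
  have h4 : ∀ x : V, (c ^ Module.finrank ℝ V * Real.exp (-π * ‖c • x‖ ^ 2)) • K x =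
      ((c ^ Module.finrank ℝ V : ℝ) : ℂ) *
        (K x * Complex.exp (-((π * c ^ 2 : ℝ) : ℂ) * ‖x‖ ^ 2)) := by
    intro x
    rw [Complex.real_smul, norm_smul, Real.norm_of_nonneg hc.le]
    push_cast
    rw [show -(π : ℂ) * (↑c * ↑‖x‖) ^ 2 = -(↑π * ↑c ^ 2) * ↑‖x‖ ^ 2 by ring]
    ring
  simp_rw [h4, integral_const_mul, h3, mul_zero]

end GaussianIntegrals

section LaguerreGeneratingFunction

/-- The generating function of the Laguerre polynomials of type `d`. -/
lemma hasSum_lagPoly (d : ℕ) (x : ℝ) {r : ℂ} (hr : ‖r‖ < 1) :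
    HasSum (fun k => r ^ k * (lagPoly (d + 1) k x : ℂ))
      ((1 - r)⁻¹ ^ (d + 1) * Complex.exp (-(x : ℂ) * r / (1 - r))) := by
  have hr1 : 1 - r ≠ 0 := by
    intro h
    rw [sub_eq_zero] at h
    simp [← h] at hr
  set f : ℕ × ℕ → ℂ := fun p =>
    (((p.2 + (p.1 + d)).choose (p.1 + d) : ℕ) : ℂ) * r ^ p.2 *
      ((r * -(x : ℂ)) ^ p.1 / (p.1.factorial : ℂ)) with hf
  have hrow : ∀ (s : ℂ), ‖s‖ < 1 → ∀ j : ℕ,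
      HasSum (fun i => (((i + (j + d)).choose (j + d) : ℕ) : ℂ) * s ^ i)
        ((1 - s)⁻¹ ^ (j + d + 1)) := by
    intro s hs j
    simpa using hasSum_choose_mul_geometric_of_norm_lt_one (j + d) hs
  have hexp : ∀ q y : ℂ, HasSum (fun j : ℕ => q ^ (j + d + 1) * (y ^ j / (j.factorial : ℂ)))
      (q ^ (d + 1) * Complex.exp (q * y)) := by
    intro q y
    have h := (NormedSpace.expSeries_div_hasSum_exp (𝔸 := ℂ) (q * y)).mul_left (q ^ (d + 1))
    rw [← Complex.exp_eq_exp_ℂ] at h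
    refine h.congr_fun fun j => ?_
    rw [mul_pow]; ring
  have hrowf : ∀ j, HasSum (fun i => f (j, i))
      ((1 - r)⁻¹ ^ (j + d + 1) * ((r * -(x : ℂ)) ^ j / (j.factorial : ℂ))) := by
    intro j
    have h := (hrow r hr j).mul_right ((r * -(x : ℂ)) ^ j / (j.factorial : ℂ))
    simpa only [hf] using h
  have hnormrow : ∀ j, HasSum (fun i => ‖f (j, i)‖)
      ((1 - ‖r‖)⁻¹ ^ (j + d + 1) * (‖r * -(x : ℂ)‖ ^ j / (j.factorial : ℝ))) := by
    intro j
    have h := (hrow (‖r‖ : ℂ) (by simpa using hr) j).mul_right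
      (((‖r * -(x : ℂ)‖ ^ j / (j.factorial : ℝ) : ℝ) : ℂ))
    rw [← Complex.hasSum_ofReal]
    convert! h using 2
    · rw [hf]; simp
    · push_cast; ring
  have hsum : Summable f := by
    refine Summable.of_norm ((summable_prod_of_nonneg fun _ => norm_nonneg _).2
      ⟨fun j => (hnormrow j).summable, ?_⟩)
    simp_rw [fun j => (hnormrow j).tsum_eq]
    rw [← Complex.summable_ofReal]
    convert! (hexp ((1 - ‖r‖ : ℝ)⁻¹ : ℂ) ((‖r * -(x : ℂ)‖ : ℝ) : ℂ)).summable using 2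
    push_cast; ring
  have htot : HasSum f ((1 - r)⁻¹ ^ (d + 1) * Complex.exp (-(x : ℂ) * r / (1 - r))) := by
    have h1 := hsum.hasSum.prod_fiberwise hrowf
    have h2 := hexp ((1 - r)⁻¹) (r * -(x : ℂ))
    convert! hsum.hasSum using 1
    rw [h1.unique h2]
    congr 2
    field_simp
  have hanti := (Finset.HasAntidiagonal.sigmaAntidiagonalEquivProd (A := ℕ)).hasSum_iff.2 htot
  have hs := hanti.sigma fun k => hasSum_fintype _
  refine hs.congr_fun fun k => ?_
  have h3 : ∀ g : ℕ × ℕ → ℂ, ∑ b : Finset.HasAntidiagonal.antidiagonal k,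
      (g ∘ (Finset.HasAntidiagonal.sigmaAntidiagonalEquivProd (A := ℕ))) ⟨k, b⟩ =
      ∑ p ∈ Finset.HasAntidiagonal.antidiagonal k, g p := by
    intro g
    exact Finset.sum_coe_sort _ g
  rw [h3, Finset.Nat.sum_antidiagonal_eq_sum_range_succ_mk, lagPoly, Complex.ofReal_sum,
    Finset.mul_sum]
  refine Finset.sum_congr rfl fun j hj => ?_
  have hjk : j ≤ k := Nat.lt_succ_iff.1 (Finset.mem_range.1 hj)
  have hc : (k + (d + 1) - 1).choose (k - j) = (k - j + (j + d)).choose (j + d) := by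
    rw [← Nat.choose_symm_add, show k + (d + 1) - 1 = k - j + (j + d) by omega]
  rw [hc, hf]
  dsimp only
  push_cast
  rw [mul_pow, show r ^ k = r ^ (k - j) * r ^ j by rw [← pow_add, Nat.sub_add_cancel hjk]]
  ring

lemma abs_lagPoly_le (d k : ℕ) {x : ℝ} (hx : 0 ≤ x) :
    |lagPoly (d + 1) k x| ≤ lagPoly (d + 1) k (-x) := by
  unfold lagPoly
  refine (Finset.abs_sum_le_sum_abs _ _).trans (Finset.sum_le_sum fun j _ => le_of_eq ?_)
  rw [abs_div, abs_mul, abs_pow, abs_neg, neg_neg, abs_of_nonneg hx, Nat.abs_cast, Nat.abs_cast]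

@[fun_prop]
lemma continuous_lagPoly (m k : ℕ) : Continuous (lagPoly m k) := by
  unfold lagPoly
  fun_prop

end LaguerreGeneratingFunction

section LiouvilleForPowerSeries

/-- A power series that continues to an entire function vanishing at infinity is zero. -/
lemma eq_zero_of_hasSum_of_tendsto_cocompact {c : ℕ → ℂ} {H : ℂ → ℂ} {ρ R₁ R₀ : ℝ}
    (hρ : 0 < ρ) (hρ1 : ρ < 1) (hR₁ : 1 < R₁) (hR : R₁ < R₀)
    (hc : ∀ R : ℝ, 0 ≤ R → R < R₀ → Summable fun k => ‖c k‖ * R ^ k)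
    (hH : ∀ r : ℂ, r.re < 1 ∨ R₁ < ‖r‖ → DifferentiableAt ℂ H r)
    (hcH : ∀ r : ℂ, ‖r‖ < ρ → HasSum (fun k => c k * r ^ k) (H r))
    (hlim : Tendsto H (cocompact ℂ) (nhds 0)) {r : ℂ} (hr : r.re < 1) (hr' : ‖r‖ < R₀) :
    H r = 0 := by
  set P : ℂ → ℂ := fun r => ∑' k, c k * r ^ k with hP
  have hPd : ∀ r : ℂ, ‖r‖ < R₀ → DifferentiableAt ℂ P r := by
    intro r hr
    obtain ⟨R, h1, h2⟩ := exists_between hr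
    have hRn : 0 ≤ R := (norm_nonneg r).trans h1.le
    refine (differentiableOn_tsum_of_summable_norm (U := Metric.ball 0 R) (hc R hRn h2)
      (fun k => by fun_prop) Metric.isOpen_ball fun k w hw => ?_).differentiableAt
      (Metric.isOpen_ball.mem_nhds (by simpa using h1))
    rw [norm_mul, norm_pow]
    gcongr
    simpa using (mem_ball_zero_iff.1 hw).le
  set A : Set ℂ := {r | r.re < 1} ∩ Metric.ball 0 R₀ with hA
  set N : Set ℂ := Complex.exp '' {s : ℂ | Real.log R₁ < s.re ∧ s.re < Real.log R₀} with hN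
  have hR₁0 : 0 < R₁ := by linarith
  have hR₀0 : 0 < R₀ := by linarith
  have hNmem : ∀ r : ℂ, r ∈ N ↔ R₁ < ‖r‖ ∧ ‖r‖ < R₀ := by
    intro r
    constructor
    · rintro ⟨s, hs, rfl⟩
      rw [Complex.norm_exp]
      exact ⟨(Real.log_lt_iff_lt_exp hR₁0).1 hs.1, (Real.lt_log_iff_exp_lt hR₀0).1 hs.2⟩
    · rintro ⟨h1, h2⟩
      have hr0 : r ≠ 0 := by
        rintro rfl
        simp at h1; linarith
      refine ⟨Complex.log r, ⟨?_, ?_⟩, Complex.exp_log hr0⟩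
      · rw [Complex.log_re]; exact Real.log_lt_log hR₁0 h1
      · rw [Complex.log_re]; exact Real.log_lt_log (norm_pos_iff.2 hr0) h2
  have hAopen : IsOpen A := (isOpen_lt Complex.continuous_re continuous_const).inter
    Metric.isOpen_ball
  have hNopen : IsOpen N := by
    have : N = {r : ℂ | R₁ < ‖r‖} ∩ {r : ℂ | ‖r‖ < R₀} := Set.ext hNmem
    rw [this]
    exact (isOpen_lt continuous_const continuous_norm).inter
      (isOpen_lt continuous_norm continuous_const)
  have hApre : IsPreconnected A :=
    ((convex_halfSpace_re_lt 1).inter (convex_ball 0 R₀)).isPreconnected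
  have hNpre : IsPreconnected N := by
    refine IsPreconnected.image ?_ _ Complex.continuous_exp.continuousOn
    exact ((convex_halfSpace_re_gt _).inter (convex_halfSpace_re_lt _)).isPreconnected
  have hpre : IsPreconnected (A ∪ N) := by
    refine IsPreconnected.union (-((R₁ + R₀) / 2 : ℝ) : ℂ) ⟨?_, ?_⟩ ?_ hApre hNpre
    · simp; linarith
    · rw [mem_ball_zero_iff, norm_neg, Complex.norm_real, Real.norm_of_nonneg (by linarith)]
      linarith
    · rw [hNmem, norm_neg, Complex.norm_real, Real.norm_of_nonneg (by linarith)]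
      constructor <;> linarith
  have hlt : ∀ r ∈ A ∪ N, ‖r‖ < R₀ := by
    rintro r (h | h)
    · simpa using h.2
    · exact ((hNmem r).1 h).2
  have heq : Set.EqOn P H (A ∪ N) := by
    refine AnalyticOnNhd.eqOn_of_preconnected_of_eventuallyEq (𝕜 := ℂ) (z₀ := 0) ?_ ?_ hpre
      (Or.inl ⟨by simp, by simpa using hR₀0⟩) ?_
    · exact DifferentiableOn.analyticOnNhd
        (fun r hr => (hPd r (hlt r hr)).differentiableWithinAt) (hAopen.union hNopen)
    · refine DifferentiableOn.analyticOnNhd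
        (fun r hr => (hH r ?_).differentiableWithinAt) (hAopen.union hNopen)
      exact hr.imp (fun h => h.1) fun h => ((hNmem r).1 h).1
    · filter_upwards [Metric.ball_mem_nhds (0 : ℂ) hρ] with r hr
      exact (hcH r (by simpa using hr)).tsum_eq
  classical
  set E : ℂ → ℂ := fun r => if ‖r‖ < R₀ then P r else H r with hE
  have hEd : Differentiable ℂ E := by
    intro r
    rcases lt_or_ge ‖r‖ R₀ with h | h
    · refine (hPd r h).congr_of_eventuallyEq ?_
      filter_upwards [(isOpen_lt continuous_norm continuous_const).mem_nhds h] with w hw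
      exact if_pos hw
    · have h1 : R₁ < ‖r‖ := hR.trans_le h
      refine (hH r (Or.inr h1)).congr_of_eventuallyEq ?_
      filter_upwards [(isOpen_lt continuous_const continuous_norm).mem_nhds h1] with w hw
      by_cases hw' : ‖w‖ < R₀
      · simp only [hE, if_pos hw']
        exact heq (Or.inr ((hNmem w).2 ⟨hw, hw'⟩))
      · simp only [hE, if_neg hw']
  have hElim : Tendsto E (cocompact ℂ) (nhds 0) := by
    refine hlim.congr' ?_
    filter_upwards [(isCompact_closedBall (0 : ℂ) R₀).compl_mem_cocompact] with w hw
    have : ¬ ‖w‖ < R₀ := fun h => hw (by simpa using h.le)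
    simp only [hE, if_neg this]
  have h0 := hEd.apply_eq_of_tendsto_cocompact r hElim
  simp only [hE, if_pos hr'] at h0
  rw [← heq (Or.inl ⟨hr, by simpa using hr'⟩), h0]

end LiouvilleForPowerSeries

section LaguerreUniqueness

lemma neg_le_re_one_add_div_one_sub {R₁ : ℝ} (hR₁ : 1 < R₁) {r : ℂ} (hr : r.re < 1 ∨ R₁ < ‖r‖) :
    1 - r ≠ 0 ∧ -((R₁ + 1) / (R₁ - 1)) ≤ ((1 + r) / (1 - r)).re := by
  have hne : 1 - r ≠ 0 := by
    intro h
    rw [sub_eq_zero] at h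
    rw [← h] at hr
    simp at hr
    linarith
  refine ⟨hne, ?_⟩
  have hpos : 0 < Complex.normSq (1 - r) := Complex.normSq_pos.2 hne
  have hn1 : Complex.normSq (1 - r) = 1 - 2 * r.re + ‖r‖ ^ 2 := by
    rw [← Complex.normSq_eq_norm_sq, Complex.normSq_apply, Complex.normSq_apply]
    simp; ring
  have hre : ((1 + r) / (1 - r)).re = (1 - ‖r‖ ^ 2) / Complex.normSq (1 - r) := by
    rw [← Complex.normSq_eq_norm_sq, Complex.div_re, Complex.normSq_apply r]
    simp
    field_simp
    ring
  have hg : 1 ≤ (R₁ + 1) / (R₁ - 1) := by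
    rw [le_div_iff₀ (by linarith)]; linarith
  rw [hre, le_div_iff₀ hpos, neg_mul, neg_le]
  rcases hr with hr | hr
  · calc -(1 - ‖r‖ ^ 2) ≤ 1 * Complex.normSq (1 - r) := by rw [hn1]; linarith
      _ ≤ _ := by gcongr
  · have h1 : |r.re| ≤ ‖r‖ := Complex.abs_re_le_norm r
    have h2 : (‖r‖ - 1) ^ 2 ≤ Complex.normSq (1 - r) := by
      rw [hn1]; nlinarith [(abs_le.1 h1).2]
    have h3 : ‖r‖ + 1 ≤ (R₁ + 1) / (R₁ - 1) * (‖r‖ - 1) := by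
      rw [div_mul_eq_mul_div, le_div_iff₀ (by linarith)]
      nlinarith
    calc -(1 - ‖r‖ ^ 2) = (‖r‖ + 1) * (‖r‖ - 1) := by ring
      _ ≤ ((R₁ + 1) / (R₁ - 1) * (‖r‖ - 1)) * (‖r‖ - 1) := by
          gcongr; linarith
      _ = (R₁ + 1) / (R₁ - 1) * (‖r‖ - 1) ^ 2 := by ring
      _ ≤ _ := by gcongr

variable {V : Type*} [NormedAddCommGroup V] [InnerProductSpace ℝ V] [FiniteDimensional ℝ V]
  [MeasurableSpace V] [BorelSpace V]

/-- The generating function of the Laguerre coefficients of a function of Gaussian decay. -/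
lemma hasSum_laguerre_coefficients {K : V → ℂ} (hK : Continuous K) {M κ : ℝ} (hκ : 0 < κ)
    (hKM : ∀ w, ‖K w‖ ≤ M * Real.exp (-κ * ‖w‖ ^ 2)) (d : ℕ) {μ : ℝ} (hμ : 0 < μ)
    {r : ℂ} (hr : ‖r‖ < 1 / 3) :
    HasSum (fun k => (∫ w, K w * ((lagPoly (d + 1) k (μ * ‖w‖ ^ 2 / 2) *
        Real.exp (-(μ * ‖w‖ ^ 2 / 4)) : ℝ) : ℂ)) * r ^ k)
      ((1 - r)⁻¹ ^ (d + 1) *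
        ∫ w, K w * Complex.exp (-((μ / 4 : ℝ) * ((1 + r) / (1 - r))) * ‖w‖ ^ 2)) := by
  have hM : 0 ≤ M := by
    have := (norm_nonneg _).trans (hKM 0)
    simpa using this
  have hr1 : ‖r‖ < 1 := hr.trans (by norm_num)
  have hne : 1 - r ≠ 0 := by
    intro h
    rw [sub_eq_zero] at h
    simp [← h] at hr1
  have hb : ∀ w : V, HasSum (fun k => M * Real.exp (-κ * ‖w‖ ^ 2) *
      (((1 / 3 : ℝ) ^ k * lagPoly (d + 1) k (-(μ * ‖w‖ ^ 2 / 2))) *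
        Real.exp (-(μ * ‖w‖ ^ 2 / 4))))
      (M * (3 / 2) ^ (d + 1) * Real.exp (-κ * ‖w‖ ^ 2)) := by
    intro w
    have h := hasSum_lagPoly d (-(μ * ‖w‖ ^ 2 / 2)) (r := ((1 / 3 : ℝ) : ℂ))
      (by rw [Complex.norm_real]; norm_num)
    have h' : HasSum (fun k => (1 / 3 : ℝ) ^ k * lagPoly (d + 1) k (-(μ * ‖w‖ ^ 2 / 2)))
        ((3 / 2) ^ (d + 1) * Real.exp (μ * ‖w‖ ^ 2 / 4)) := by
      rw [← Complex.hasSum_ofReal]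
      convert! h using 2
      · push_cast; ring
      · push_cast
        congr 2
        · norm_num
        · norm_num; ring
    convert! (h'.mul_right (Real.exp (-(μ * ‖w‖ ^ 2 / 4)))).mul_left
      (M * Real.exp (-κ * ‖w‖ ^ 2)) using 1
    rw [mul_assoc ((3 / 2 : ℝ) ^ (d + 1)), ← Real.exp_add, add_neg_cancel, Real.exp_zero]
    ring
  have key := hasSum_integral_of_dominated_convergence (μ := (volume : Measure V))
    (F := fun k w => K w * ((lagPoly (d + 1) k (μ * ‖w‖ ^ 2 / 2) *
        Real.exp (-(μ * ‖w‖ ^ 2 / 4)) : ℝ) : ℂ) * r ^ k)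
    (f := fun w => (1 - r)⁻¹ ^ (d + 1) *
        (K w * Complex.exp (-((μ / 4 : ℝ) * ((1 + r) / (1 - r))) * ‖w‖ ^ 2)))
    (fun k w => M * Real.exp (-κ * ‖w‖ ^ 2) *
      (((1 / 3 : ℝ) ^ k * lagPoly (d + 1) k (-(μ * ‖w‖ ^ 2 / 2))) *
        Real.exp (-(μ * ‖w‖ ^ 2 / 4))))
    (fun k => by fun_prop) (fun k => ae_of_all _ fun w => ?_)
    (ae_of_all _ fun w => (hb w).summable) ?_ (ae_of_all _ fun w => ?_)
  · simpa only [integral_mul_const, integral_const_mul] using key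
  · rw [norm_mul, norm_mul, norm_pow, Complex.norm_real, norm_mul, Real.norm_eq_abs,
      Real.norm_of_nonneg (Real.exp_pos _).le]
    have h1 := abs_lagPoly_le d k (x := μ * ‖w‖ ^ 2 / 2) (by positivity)
    calc _ ≤ (M * Real.exp (-κ * ‖w‖ ^ 2)) * (lagPoly (d + 1) k (-(μ * ‖w‖ ^ 2 / 2)) *
          Real.exp (-(μ * ‖w‖ ^ 2 / 4))) * (1 / 3) ^ k := by
          have := hKM w
          have h0 : 0 ≤ lagPoly (d + 1) k (-(μ * ‖w‖ ^ 2 / 2)) := (abs_nonneg _).trans h1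
          gcongr
      _ = _ := by ring
  · simp_rw [fun w => (hb w).tsum_eq]
    exact (integrable_rexp_neg_mul_norm_sq hκ).const_mul _
  · have h := ((hasSum_lagPoly d (μ * ‖w‖ ^ 2 / 2) hr1).mul_right
      (Complex.exp (-(μ * ‖w‖ ^ 2 / 4 : ℝ)))).mul_left (K w)
    convert! h using 1
    · funext k
      push_cast
      ring
    · rw [mul_assoc ((1 - r)⁻¹ ^ (d + 1)), ← Complex.exp_add, mul_left_comm]
      congr 3
      push_cast
      field_simp
      ring

/-- A function of Gaussian decay whose Laguerre coefficients decay too fast vanishes at `0`. -/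
lemma eq_zero_of_laguerre_coefficients_le {K : V → ℂ} (hK : Continuous K) {M κ : ℝ} (hκ : 0 < κ)
    (hKM : ∀ w, ‖K w‖ ≤ M * Real.exp (-κ * ‖w‖ ^ 2)) (d : ℕ) {μ R₁ R₀ B : ℝ} (hμ : 0 < μ)
    (hR₁ : 1 < R₁) (hR : R₁ < R₀) (hκR : μ / 4 * ((R₁ + 1) / (R₁ - 1)) < κ)
    (hB : ∀ k, ‖∫ w, K w * ((lagPoly (d + 1) k (μ * ‖w‖ ^ 2 / 2) *
      Real.exp (-(μ * ‖w‖ ^ 2 / 4)) : ℝ) : ℂ)‖ ≤ B * ((k + d).choose d : ℝ) * (R₀⁻¹) ^ k) :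
    K 0 = 0 := by
  set Q : ℂ → ℂ := fun s => ∫ w, K w * Complex.exp (-s * ‖w‖ ^ 2) with hQ
  set H : ℂ → ℂ := fun r => (1 - r)⁻¹ ^ (d + 1) * Q ((μ / 4 : ℝ) * ((1 + r) / (1 - r))) with hH
  have hR₀ : 0 < R₀ := by linarith
  have hre : ∀ r : ℂ, r.re < 1 ∨ R₁ < ‖r‖ →
      -(μ / 4 * ((R₁ + 1) / (R₁ - 1))) ≤ ((μ / 4 : ℝ) * ((1 + r) / (1 - r)) : ℂ).re := by
    intro r hr
    rw [Complex.re_ofReal_mul, ← mul_neg]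
    have := (neg_le_re_one_add_div_one_sub hR₁ hr).2
    gcongr
  have hzero : ∀ r : ℂ, r.re < 1 → ‖r‖ < R₀ → H r = 0 := by
    intro r hr hr'
    refine eq_zero_of_hasSum_of_tendsto_cocompact (H := H) (ρ := 1 / 3) (by norm_num) (by norm_num)
      hR₁ hR (c := fun k => ∫ w, K w * ((lagPoly (d + 1) k (μ * ‖w‖ ^ 2 / 2) *
        Real.exp (-(μ * ‖w‖ ^ 2 / 4)) : ℝ) : ℂ)) ?_ ?_
      (fun r hr => hasSum_laguerre_coefficients hK hκ hKM d hμ hr) ?_ hr hr'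
    · intro R hR0 hRR
      have hs := (summable_choose_mul_geometric_of_norm_lt_one d (r := R / R₀) (by
        rw [Real.norm_of_nonneg (by positivity), div_lt_one hR₀]; exact hRR)).mul_left B
      refine hs.of_nonneg_of_le (fun k => by positivity) fun k => ?_
      calc _ ≤ (B * ((k + d).choose d : ℝ) * (R₀⁻¹) ^ k) * R ^ k := by gcongr; exact hB k
        _ = _ := by rw [div_pow, inv_pow]; ring
    · intro r hr
      have h1 := (neg_le_re_one_add_div_one_sub hR₁ hr).1
      have h2 := hre r hr
      have h3 : DifferentiableAt ℂ Q ((μ / 4 : ℝ) * ((1 + r) / (1 - r))) :=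
        differentiableAt_integral_mul_cexp_norm_sq hK hKM (by linarith)
      have h4 : DifferentiableAt ℂ (fun r : ℂ => ((μ / 4 : ℝ) : ℂ) * ((1 + r) / (1 - r))) r :=
        ((by fun_prop : DifferentiableAt ℂ (fun r : ℂ => 1 + r) r).div (by fun_prop) h1).const_mul _
      have h5 : DifferentiableAt ℂ (fun r : ℂ => (1 - r)⁻¹ ^ (d + 1)) r :=
        (DifferentiableAt.inv (by fun_prop) h1).pow _
      exact h5.mul (DifferentiableAt.comp (g := Q) r h3 h4)
    · set L : ℝ := ∫ w : V, M * Real.exp (-(κ - μ / 4 * ((R₁ + 1) / (R₁ - 1))) * ‖w‖ ^ 2)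
      have hQL : ∀ r : ℂ, R₁ < ‖r‖ → ‖Q ((μ / 4 : ℝ) * ((1 + r) / (1 - r)))‖ ≤ L := by
        intro r hr
        refine norm_integral_le_of_norm_le
          ((integrable_rexp_neg_mul_norm_sq (by linarith)).const_mul _) (ae_of_all _ fun w => ?_)
        rw [norm_mul, Complex.norm_exp, ← Complex.ofReal_pow, Complex.re_mul_ofReal, Complex.neg_re]
        calc _ ≤ (M * Real.exp (-κ * ‖w‖ ^ 2)) *
              Real.exp ((μ / 4 * ((R₁ + 1) / (R₁ - 1))) * ‖w‖ ^ 2) := by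
              have := hre r (Or.inr hr)
              gcongr
              · exact (norm_nonneg _).trans (hKM w)
              · exact hKM w
              · linarith
          _ = _ := by rw [mul_assoc, ← Real.exp_add]; congr 2; ring
      have hinv : Tendsto (fun r : ℂ => (1 - r)⁻¹ ^ (d + 1)) (cocompact ℂ) (nhds 0) := by
        have h1 : Tendsto (fun r : ℂ => 1 - r) (cocompact ℂ) (cocompact ℂ) :=
          (Homeomorph.subLeft (1 : ℂ)).isClosedEmbedding.tendsto_cocompact
        have h2 : Tendsto (fun r : ℂ => (1 - r)⁻¹) (cocompact ℂ) (nhds 0) :=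
          (tendsto_inv₀_cobounded.mono_left (by rw [Metric.cobounded_eq_cocompact])).comp h1
        simpa using h2.pow (d + 1)
      have hL : Tendsto (fun r : ℂ => ‖(1 - r)⁻¹ ^ (d + 1)‖ * L) (cocompact ℂ) (nhds 0) := by
        simpa using hinv.norm.mul_const L
      refine squeeze_zero_norm' ?_ hL
      filter_upwards [(isCompact_closedBall (0 : ℂ) R₁).compl_mem_cocompact] with r hr
      have hr' : R₁ < ‖r‖ := by simpa using hr
      rw [hH, norm_mul]
      gcongr
      exact hQL r hr'
  refine eq_zero_of_integral_mul_gaussian_eq_zero hK ?_ fun u hu => ?_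
  · exact ((integrable_rexp_neg_mul_norm_sq hκ).const_mul M).mono' (by fun_prop)
      (ae_of_all _ hKM)
  · set v : ℝ := 4 * u / μ with hv
    have hv0 : 0 < v := by positivity
    have hvr : ‖(((v - 1) / (v + 1) : ℝ) : ℂ)‖ < 1 := by
      rw [Complex.norm_real, Real.norm_eq_abs, abs_lt]
      constructor
      · rw [lt_div_iff₀ (by linarith)]; linarith
      · rw [div_lt_one (by linarith)]; linarith
    have h := hzero (((v - 1) / (v + 1) : ℝ) : ℂ)
      (by rw [Complex.ofReal_re, div_lt_one (by linarith)]; linarith) (by linarith)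
    have hv1 : (1 : ℝ) - (v - 1) / (v + 1) ≠ 0 := by
      have : v + 1 ≠ 0 := by linarith
      field_simp
      norm_num
      exact this
    have hval : ((μ / 4 : ℝ) * ((1 + (((v - 1) / (v + 1) : ℝ) : ℂ)) /
        (1 - (((v - 1) / (v + 1) : ℝ) : ℂ))) : ℂ) = (u : ℂ) := by
      norm_cast
      have : v + 1 ≠ 0 := by linarith
      rw [show (1 + (v - 1) / (v + 1)) / (1 - (v - 1) / (v + 1)) = v by field_simp; ring, hv]
      field_simp
    simp only [hH, hval] at h
    refine (mul_eq_zero.1 h).resolve_left (pow_ne_zero _ (inv_ne_zero ?_))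
    exact_mod_cast hv1

end LaguerreUniqueness

section TwistedPairing

variable {V : Type*} [NormedAddCommGroup V] [InnerProductSpace ℝ V] [FiniteDimensional ℝ V]
  [MeasurableSpace V] [BorelSpace V]

lemma continuous_twisted_pairing {F : V → ℂ} (hF : Integrable F) {χ : V → ℝ} (hχ : Continuous χ)
    (hχs : HasCompactSupport χ) {e : V → V → ℂ} (he : Continuous (Function.uncurry e))
    (he1 : ∀ z w, ‖e z w‖ = 1) :
    Continuous fun w => ∫ z, F (z - w) * (χ z : ℂ) * e z w := by
  have h : ∀ w, ∫ z, F (z - w) * (χ z : ℂ) * e z w = ∫ y, F y * (χ (y + w) : ℂ) * e (y + w) w :=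
    fun w => by
      rw [← integral_sub_right_eq_self (fun y => F y * (χ (y + w) : ℂ) * e (y + w) w) w]
      simp
  simp_rw [h]
  obtain ⟨C, hC⟩ := hχ.bounded_above_of_compact_support hχs
  have hc : ∀ y, Continuous fun w => e (y + w) w := fun y =>
    he.comp (f := fun w => (y + w, w)) (by fun_prop)
  have hc' : ∀ w, Continuous fun y => e (y + w) w := fun w =>
    he.comp (f := fun y => (y + w, w)) (by fun_prop)
  refine continuous_of_dominated (bound := fun y => ‖F y‖ * C) (fun w => ?_)
    (fun w => ae_of_all _ fun y => ?_) (hF.norm.mul_const C) (ae_of_all _ fun y => ?_)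
  · exact (hF.aestronglyMeasurable.mul
      (by fun_prop : Continuous fun y => (χ (y + w) : ℂ)).aestronglyMeasurable).mul
      (hc' w).aestronglyMeasurable
  · rw [norm_mul, norm_mul, he1, mul_one, Complex.norm_real]
    gcongr
    exact hC _
  · exact (continuous_const.mul (by fun_prop)).mul (hc y)

lemma norm_twisted_pairing_le {F : V → ℂ} {M κ κ' : ℝ} (hM : 0 ≤ M) (hκ' : 0 < κ') (hκ : κ' < κ)
    (hFM : ∀ z, ‖F z‖ ≤ M * Real.exp (-κ * ‖z‖ ^ 2)) {χ : V → ℝ} (hχ : Continuous χ)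
    (hχs : HasCompactSupport χ) {e : V → V → ℂ} (he1 : ∀ z w, ‖e z w‖ = 1) :
    ∃ M', ∀ w, ‖∫ z, F (z - w) * (χ z : ℂ) * e z w‖ ≤ M' * Real.exp (-κ' * ‖w‖ ^ 2) := by
  obtain ⟨ρ, hρ⟩ := (hχs.isCompact.isBounded).exists_norm_le
  have hχi : Integrable χ := hχ.integrable_of_hasCompactSupport hχs
  set D : ℝ := κ * κ' / (κ - κ') * ρ ^ 2 with hD
  have hquad : ∀ s t : ℝ, 0 ≤ s → s ≤ ρ → κ' * t ^ 2 ≤ κ * (t - s) ^ 2 + D := by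
    intro s t hs hsρ
    have hd : 0 < κ - κ' := by linarith
    have h1 : D = κ * κ' / (κ - κ') * s ^ 2 + κ * κ' / (κ - κ') * (ρ ^ 2 - s ^ 2) := by
      rw [hD]; ring
    have h2 : 0 ≤ κ * κ' / (κ - κ') * (ρ ^ 2 - s ^ 2) := by
      have : s ^ 2 ≤ ρ ^ 2 := by gcongr
      have : 0 < κ := by linarith
      have : 0 ≤ ρ ^ 2 - s ^ 2 := by linarith
      positivity
    have h3 : κ * (t - s) ^ 2 + κ * κ' / (κ - κ') * s ^ 2 - κ' * t ^ 2 =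
        (κ - κ')⁻¹ * ((κ - κ') * t - κ * s) ^ 2 := by
      field_simp
      ring
    have h4 : 0 ≤ (κ - κ')⁻¹ * ((κ - κ') * t - κ * s) ^ 2 := by positivity
    linarith
  refine ⟨∫ z, M * Real.exp D * ‖χ z‖, fun w => ?_⟩
  rw [← integral_mul_const]
  refine norm_integral_le_of_norm_le ((hχi.norm.const_mul _).mul_const _) (ae_of_all _ fun z => ?_)
  rw [norm_mul, norm_mul, he1, mul_one, Complex.norm_real]
  by_cases hz : χ z = 0
  · simp [hz]
  have hzρ : ‖z‖ ≤ ρ := hρ z (subset_tsupport _ hz)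
  have h5 := hquad ‖z‖ ‖w‖ (norm_nonneg _) hzρ
  have h6 : (‖w‖ - ‖z‖) ^ 2 ≤ ‖z - w‖ ^ 2 := by
    rw [← sq_abs]
    have := abs_norm_sub_norm_le w z
    rw [norm_sub_rev] at this
    gcongr
  have h7 : κ * (‖w‖ - ‖z‖) ^ 2 ≤ κ * ‖z - w‖ ^ 2 := by
    have : 0 < κ := by linarith
    gcongr
  calc ‖F (z - w)‖ * ‖χ z‖ ≤ (M * Real.exp (-κ * ‖z - w‖ ^ 2)) * ‖χ z‖ := by
        gcongr; exact hFM _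
    _ ≤ (M * Real.exp (D + -κ' * ‖w‖ ^ 2)) * ‖χ z‖ := by
        gcongr; linarith
    _ = _ := by rw [Real.exp_add]; ring

lemma integrable_twisted_integrand {F G : V → ℂ} (hF : Integrable F) (hG : Integrable G)
    {e : V → V → ℂ} (he : Continuous (Function.uncurry e)) (he1 : ∀ z w, ‖e z w‖ = 1) :
    Integrable (fun p : V × V => F (p.1 - p.2) * G p.2 * e p.1 p.2) (volume.prod volume) := by
  have h := hG.convolution_integrand (ContinuousLinearMap.mul ℂ ℂ) hF
  have h' : Integrable (fun p : V × V => F (p.1 - p.2) * G p.2) (volume.prod volume) := by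
    refine h.congr (ae_of_all _ fun p => ?_)
    simp [mul_comm]
  exact h'.mul_bdd (c := 1) he.aestronglyMeasurable (ae_of_all _ fun p => (he1 _ _).le)

lemma integral_twisted_pairing_mul {F G : V → ℂ} (hF : Integrable F) (hG : Integrable G)
    {χ : V → ℝ} (hχ : Continuous χ) (hχs : HasCompactSupport χ) {e : V → V → ℂ}
    (he : Continuous (Function.uncurry e)) (he1 : ∀ z w, ‖e z w‖ = 1) :
    ∫ w, (∫ z, F (z - w) * (χ z : ℂ) * e z w) * G w =
      ∫ z, (χ z : ℂ) * ∫ w, F (z - w) * G w * e z w := by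
  obtain ⟨C, hC⟩ := hχ.bounded_above_of_compact_support hχs
  have h := (integrable_twisted_integrand hF hG he he1).bdd_mul (c := C)
    (f := fun p : V × V => (χ p.1 : ℂ))
    (by fun_prop : Continuous fun p : V × V => (χ p.1 : ℂ)).aestronglyMeasurable
    (ae_of_all _ fun p => by rw [Complex.norm_real]; exact hC _)
  simp_rw [← integral_mul_const, ← integral_const_mul]
  rw [integral_integral_swap (f := fun z w => (χ z : ℂ) * (F (z - w) * G w * e z w)) h]
  refine integral_congr_ae (ae_of_all _ fun w => integral_congr_ae (ae_of_all _ fun z => ?_))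
  dsimp only
  ring

lemma integrable_norm_sq_twisted {F G : V → ℂ} (hF : Integrable F) (hG : Integrable G) {M : ℝ}
    (hGM : ∀ w, ‖G w‖ ≤ M) {e : V → V → ℂ} (he : Continuous (Function.uncurry e))
    (he1 : ∀ z w, ‖e z w‖ = 1) :
    Integrable (fun z => ∫ w, F (z - w) * G w * e z w) ∧
      Integrable (fun z => ‖∫ w, F (z - w) * G w * e z w‖ ^ 2) := by
  have h := (integrable_twisted_integrand hF hG he he1).integral_prod_left
  refine ⟨h, ?_⟩
  have hb : ∀ z, ‖∫ w, F (z - w) * G w * e z w‖ ≤ ∫ w, ‖F w‖ * M := by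
    intro z
    rw [← integral_sub_left_eq_self (fun w => ‖F w‖ * M) volume z]
    refine norm_integral_le_of_norm_le ((hF.norm.mul_const M).comp_sub_left z)
      (ae_of_all _ fun w => ?_)
    rw [norm_mul, norm_mul, he1, mul_one]
    gcongr
    exact hGM w
  simp_rw [pow_two]
  refine h.norm.mul_bdd (c := ∫ w, ‖F w‖ * M) h.norm.aestronglyMeasurable
    (ae_of_all _ fun z => ?_)
  rw [norm_norm]
  exact hb z

end TwistedPairing

section TwistedUniqueness

lemma abs_lagPoly_le_exp (d k : ℕ) {x : ℝ} (hx : 0 ≤ x) :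
    |lagPoly (d + 1) k x| ≤ 5 ^ k * ((5 / 4) ^ (d + 1) * Real.exp (x / 4)) := by
  have hr : ‖((1 / 5 : ℝ) : ℂ)‖ < 1 := by
    rw [Complex.norm_real]; norm_num
  have h := hasSum_lagPoly d (-x) hr
  have h' : HasSum (fun k => (1 / 5 : ℝ) ^ k * lagPoly (d + 1) k (-x))
      ((5 / 4) ^ (d + 1) * Real.exp (x / 4)) := by
    rw [← Complex.hasSum_ofReal]
    convert! h using 1
    · funext k; push_cast; ring
    · push_cast
      congr 2
      · norm_num
      · ring
  have h0 : ∀ k, 0 ≤ lagPoly (d + 1) k (-x) := fun k => (abs_nonneg _).trans (abs_lagPoly_le d k hx)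
  have h1 := le_hasSum h' k fun j _ => mul_nonneg (by positivity) (h0 j)
  refine (abs_lagPoly_le d k hx).trans ?_
  calc lagPoly (d + 1) k (-x) = 5 ^ k * ((1 / 5 : ℝ) ^ k * lagPoly (d + 1) k (-x)) := by
        rw [← mul_assoc, ← mul_pow]; norm_num
    _ ≤ _ := by gcongr

lemma abs_lagFun_le (d k : ℕ) (lam : ℝ) (w : Cn (d + 1)) :
    |lagFun (d + 1) k lam w| ≤
      5 ^ k * (5 / 4) ^ (d + 1) * Real.exp (-(|lam| / 8) * ‖w‖ ^ 2) := by
  rw [lagFun, abs_mul, Real.abs_exp]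
  calc _ ≤ (5 ^ k * ((5 / 4) ^ (d + 1) * Real.exp ((|lam| * ‖w‖ ^ 2 / 2) / 4))) *
        Real.exp (-(|lam| * ‖w‖ ^ 2 / 4)) := by
        gcongr; exact abs_lagPoly_le_exp d k (by positivity)
    _ = 5 ^ k * (5 / 4) ^ (d + 1) * (Real.exp ((|lam| * ‖w‖ ^ 2 / 2) / 4) *
        Real.exp (-(|lam| * ‖w‖ ^ 2 / 4))) := by ring
    _ = _ := by
      rw [← Real.exp_add]
      congr 2
      ring

lemma continuous_lagFun (m k : ℕ) (lam : ℝ) : Continuous (lagFun m k lam) := by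
  unfold lagFun
  fun_prop

/-- The multiplier of the twisted convolution. -/
def twMul (n : ℕ) (lam : ℝ) (z w : Cn n) : ℂ :=
  Complex.exp (Complex.I / 2 * (lam : ℂ) * ((imZW z w : ℝ) : ℂ))

lemma continuous_twMul (n : ℕ) (lam : ℝ) : Continuous (Function.uncurry (twMul n lam)) := by
  have : Continuous fun p : Cn n × Cn n => imZW p.1 p.2 := by
    unfold imZW; fun_prop
  have : Continuous fun p : Cn n × Cn n => twMul n lam p.1 p.2 := by
    unfold twMul; fun_prop
  exact this

lemma norm_twMul (n : ℕ) (lam : ℝ) (z w : Cn n) : ‖twMul n lam z w‖ = 1 := by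
  have : Complex.I / 2 * (lam : ℂ) * ((imZW z w : ℝ) : ℂ) =
      ((1 / 2 * lam * imZW z w : ℝ) : ℂ) * Complex.I := by push_cast; ring
  rw [twMul, this]
  exact Complex.norm_exp_ofReal_mul_I _

lemma norm_integral_mul_le_sq {α : Type*} [MeasurableSpace α] {ν : Measure α} {u : α → ℝ} {T : α → ℂ}
    (hu : Integrable (fun z => u z ^ 2) ν) (hT : Integrable (fun z => ‖T z‖ ^ 2) ν) {s : ℝ}
    (hs : 0 < s) :
    ‖∫ z, (u z : ℂ) * T z ∂ν‖ ≤ (s * (∫ z, u z ^ 2 ∂ν) + s⁻¹ * ∫ z, ‖T z‖ ^ 2 ∂ν) / 2 := by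
  rw [← integral_const_mul, ← integral_const_mul,
    ← integral_add (hu.const_mul s) (hT.const_mul s⁻¹), ← integral_div]
  refine norm_integral_le_of_norm_le (((hu.const_mul s).add (hT.const_mul s⁻¹)).div_const 2)
    (ae_of_all _ fun z => ?_)
  rw [norm_mul, Complex.norm_real, Real.norm_eq_abs]
  have h : s * u z ^ 2 + s⁻¹ * ‖T z‖ ^ 2 - 2 * (|u z| * ‖T z‖) =
      s⁻¹ * (s * |u z| - ‖T z‖) ^ 2 := by
    rw [← sq_abs (u z)]
    field_simp
    ring
  have h' : 0 ≤ s⁻¹ * (s * |u z| - ‖T z‖) ^ 2 := by positivity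
  linarith

/-- A function of Gaussian decay all of whose twisted Laguerre projections decay too fast
vanishes almost everywhere. -/
lemma ae_eq_zero_of_twConv_lagFun_le (d : ℕ) {lam : ℝ} (hlam : lam ≠ 0) {F : Cn (d + 1) → ℂ}
    (hF : AEStronglyMeasurable F) {M κ κ' b b' A : ℝ} (hb' : 0 < b') (hb : b' < b)
    (hκ : κ' < κ) (hlamκ : |lam| + 1 / b' < 4 * κ')
    (hFM : ∀ z, ‖F z‖ ≤ M * Real.exp (-κ * ‖z‖ ^ 2))
    (hA : ∀ k : ℕ, ∫ z, ‖twConv (d + 1) (-lam) F (fun w => (lagFun (d + 1) k lam w : ℂ)) z‖ ^ 2 ≤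
      A * ((k + d).choose d : ℝ) * Real.exp (-(2 * b * (2 * k + (d + 1)) * |lam|))) :
    F =ᵐ[volume] 0 := by
  have hμ : 0 < |lam| := abs_pos.2 hlam
  have hκ' : 0 < κ' := by
    have : 0 < 1 / b' := by positivity
    linarith
  have hM : 0 ≤ M := by simpa using (norm_nonneg _).trans (hFM 0)
  have hFi : Integrable F :=
    ((integrable_rexp_neg_mul_norm_sq (hκ'.trans hκ)).const_mul M).mono' hF (ae_of_all _ hFM)
  have he := continuous_twMul (d + 1) (-lam)
  have he1 := norm_twMul (d + 1) (-lam)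
  refine ae_eq_zero_of_integral_contDiff_smul_eq_zero hFi.locallyIntegrable
    fun χ hχ hχs => ?_
  have hχc := hχ.continuous
  have hχ2 : Integrable fun z => χ z ^ 2 := by
    simp_rw [pow_two]
    exact (hχc.mul hχc).integrable_of_hasCompactSupport hχs.mul_right
  obtain ⟨M', hM'⟩ := norm_twisted_pairing_le (κ' := κ') hM hκ' hκ hFM hχc hχs he1
  have hK := continuous_twisted_pairing hFi hχc hχs he he1
  set R₀ : ℝ := 1 + 2 * b * |lam| with hR₀
  have hR₀1 : 1 < R₀ := by
    have : 0 < 2 * b * |lam| := by have := hb'.trans hb; positivity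
    linarith
  have key := eq_zero_of_laguerre_coefficients_le hK hκ' hM' d hμ (R₁ := 1 + 2 * b' * |lam|)
    (R₀ := R₀) (B := ((∫ z, χ z ^ 2) + |A|) / 2) (by linarith [mul_pos hb' hμ])
    (by rw [hR₀]; gcongr) ?_ fun k => ?_
  · simpa [twMul, imZW, mul_comm] using key
  · have h1 : |lam| / 4 * ((1 + 2 * b' * |lam| + 1) / (1 + 2 * b' * |lam| - 1)) =
        (|lam| + 1 / b') / 4 := by
      rw [show 1 + 2 * b' * |lam| - 1 = 2 * b' * |lam| by ring]
      field_simp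
      ring
    rw [h1]
    linarith
  · have hG : Integrable fun w => (lagFun (d + 1) k lam w : ℂ) := by
      refine ((integrable_rexp_neg_mul_norm_sq (c := |lam| / 8) (by positivity)).const_mul
        (5 ^ k * (5 / 4) ^ (d + 1))).mono'
        (Complex.continuous_ofReal.comp (continuous_lagFun _ k lam)).aestronglyMeasurable
        (ae_of_all _ fun w => ?_)
      rw [Complex.norm_real]
      exact abs_lagFun_le d k lam w
    have hGM : ∀ w, ‖(lagFun (d + 1) k lam w : ℂ)‖ ≤ 5 ^ k * (5 / 4) ^ (d + 1) := fun w => by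
      rw [Complex.norm_real]
      refine (abs_lagFun_le d k lam w).trans (mul_le_of_le_one_right (by positivity) ?_)
      rw [Real.exp_le_one_iff]
      have : 0 ≤ |lam| / 8 * ‖w‖ ^ 2 := by positivity
      linarith
    have hT := (integrable_norm_sq_twisted hFi hG hGM he he1).2
    have hfub := integral_twisted_pairing_mul hFi hG hχc hχs he he1
    have hle := norm_integral_mul_le_sq hχ2 hT (s := R₀⁻¹ ^ k) (by positivity)
    rw [← hfub] at hle
    have hAk : ∫ z, ‖∫ w, F (z - w) * (lagFun (d + 1) k lam w : ℂ) *
        twMul (d + 1) (-lam) z w‖ ^ 2 ≤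
        A * ((k + d).choose d : ℝ) * Real.exp (-(2 * b * (2 * k + (d + 1)) * |lam|)) := hA k
    have hexp : Real.exp (-(2 * b * (2 * k + (d + 1)) * |lam|)) ≤ R₀⁻¹ ^ k * R₀⁻¹ ^ k := by
      have hb0 : 0 < b := hb'.trans hb
      have h1 : Real.exp (-(2 * b * |lam|)) ≤ R₀⁻¹ := by
        rw [Real.exp_neg]
        gcongr
        rw [hR₀, add_comm]
        exact Real.add_one_le_exp _
      calc Real.exp (-(2 * b * (2 * k + (d + 1)) * |lam|))
          ≤ Real.exp (k * -(2 * b * |lam|) + k * -(2 * b * |lam|)) := by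
            gcongr
            have : 0 ≤ 2 * b * (d + 1) * |lam| := by positivity
            linarith
        _ = Real.exp (-(2 * b * |lam|)) ^ k * Real.exp (-(2 * b * |lam|)) ^ k := by
            rw [Real.exp_add, Real.exp_nat_mul]
        _ ≤ _ := by gcongr
    have hchoose : (1 : ℝ) ≤ ((k + d).choose d : ℝ) := by
      exact_mod_cast Nat.choose_pos (Nat.le_add_left d k)
    have hX : 0 ≤ ∫ z, χ z ^ 2 := integral_nonneg fun z => sq_nonneg _
    have hAc : ∫ z, ‖∫ w, F (z - w) * (lagFun (d + 1) k lam w : ℂ) *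
        twMul (d + 1) (-lam) z w‖ ^ 2 ≤ |A| * ((k + d).choose d : ℝ) * (R₀⁻¹ ^ k * R₀⁻¹ ^ k) :=
      hAk.trans (by gcongr; exact le_abs_self A)
    have hRk : 0 < R₀⁻¹ ^ k := by positivity
    refine hle.trans ?_
    calc _ ≤ (R₀⁻¹ ^ k * ((∫ z, χ z ^ 2) * ((k + d).choose d : ℝ)) + (R₀⁻¹ ^ k)⁻¹ *
          (|A| * ((k + d).choose d : ℝ) * (R₀⁻¹ ^ k * R₀⁻¹ ^ k))) / 2 := by
          gcongr
          exact le_mul_of_one_le_right hX hchoose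
      _ = _ := by
          generalize R₀⁻¹ ^ k = q at hRk
          field_simp

end TwistedUniqueness

section HeatKernel

lemma integrable_exp_neg_mul_abs {c : ℝ} (hc : 0 < c) :
    Integrable fun x : ℝ => Real.exp (-c * |x|) := by
  rw [← integrableOn_univ, ← Set.Iic_union_Ioi (a := (0 : ℝ)), integrableOn_union]
  constructor
  · refine (integrableOn_exp_mul_Iic hc 0).congr_fun (fun x hx => ?_) measurableSet_Iic
    simp [abs_of_nonpos (Set.mem_Iic.1 hx)]
  · refine (integrableOn_exp_mul_Ioi (neg_lt_zero.2 hc) 0).congr_fun (fun x hx => ?_)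
      measurableSet_Ioi
    simp [abs_of_pos (Set.mem_Ioi.1 hx)]

lemma integral_add_mul_I_eq_of_norm_le {g : ℂ → ℂ} {η : ℝ} {B : ℝ → ℝ}
    (hg : DifferentiableOn ℂ g {z | |z.im| ≤ |η|})
    (hB : ∀ x y : ℝ, |y| ≤ |η| → ‖g (x + y * Complex.I)‖ ≤ B x) (hBi : Integrable B)
    (hB1 : Tendsto B atTop (nhds 0)) (hB2 : Tendsto B atBot (nhds 0)) :
    ∫ x : ℝ, g x = ∫ x : ℝ, g (x + η * Complex.I) := by
  have hη : ∀ y ∈ Set.uIcc 0 η, |y| ≤ |η| := fun y hy => by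
    simpa using Set.abs_sub_left_of_mem_uIcc hy
  have hint : ∀ y : ℝ, |y| ≤ |η| → Integrable fun x : ℝ => g (x + y * Complex.I) := by
    intro y hy
    refine hBi.mono' ?_ (ae_of_all _ fun x => hB x y hy)
    refine (continuousOn_univ.1 (hg.continuousOn.comp (s := Set.univ) (by fun_prop)
      fun x _ => ?_)).aestronglyMeasurable
    simpa using hy
  have hrect : ∀ T : ℝ, (∫ x : ℝ in -T..T, g x) - (∫ x : ℝ in -T..T, g (x + η * Complex.I)) =
      Complex.I • (∫ y : ℝ in 0..η, g ((-T : ℝ) + y * Complex.I)) -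
      Complex.I • ∫ y : ℝ in 0..η, g (T + y * Complex.I) := by
    intro T
    have h := Complex.integral_boundary_rect_eq_zero_of_differentiableOn g (-T : ℝ)
      (T + η * Complex.I) (hg.mono fun z hz => ?_)
    · simp only [Complex.ofReal_re, Complex.ofReal_im, Complex.add_re, Complex.mul_re, Complex.I_re,
        Complex.I_im, Complex.add_im, Complex.mul_im, mul_zero, mul_one, zero_add, add_zero,
        Complex.ofReal_zero, zero_mul, sub_zero] at h
      linear_combination h
    · have h2 := hz.2
      simp only [Set.mem_preimage, Complex.ofReal_im, Complex.add_im, Complex.mul_im,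
        Complex.ofReal_re, Complex.I_re, Complex.I_im, mul_one, mul_zero, add_zero, zero_add] at h2
      exact hη _ h2
  have hvert : ∀ T : ℝ, ‖∫ y : ℝ in 0..η, g (T + y * Complex.I)‖ ≤ B T * |η| := by
    intro T
    have := intervalIntegral.norm_integral_le_of_norm_le_const (a := 0) (b := η) (C := B T)
      (f := fun y : ℝ => g (T + y * Complex.I)) fun y hy => hB T y (hη y (Set.uIoc_subset_uIcc hy))
    simpa using this
  have hv1 : Tendsto (fun T : ℝ => ∫ y : ℝ in 0..η, g (T + y * Complex.I)) atTop (nhds 0) :=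
    squeeze_zero_norm hvert (by simpa using hB1.mul_const |η|)
  have hv2 : Tendsto (fun T : ℝ => ∫ y : ℝ in 0..η, g ((-T : ℝ) + y * Complex.I)) atTop (nhds 0) :=
    (squeeze_zero_norm hvert (by simpa using hB2.mul_const |η|)).comp tendsto_neg_atTop_atBot
  have h0 := intervalIntegral_tendsto_integral (μ := volume) (f := fun x : ℝ => g x)
    (by simpa using hint 0 (by simp)) tendsto_neg_atTop_atBot tendsto_id
  have h1 := intervalIntegral_tendsto_integral (μ := volume) (hint η le_rfl)
    tendsto_neg_atTop_atBot tendsto_id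
  have h2 := (hv2.const_smul Complex.I).sub (hv1.const_smul Complex.I)
  refine sub_eq_zero.1 (tendsto_nhds_unique (h0.sub h1) ?_)
  simp only [id, hrect]
  simpa using h2

lemma sinh_sq_le (x : ℝ) : Real.sinh x ^ 2 ≤ x * (Real.sinh x * Real.cosh x) := by
  have hmono : MonotoneOn (fun x : ℝ => x * Real.cosh x - Real.sinh x) (Set.Ici 0) := by
    refine monotoneOn_of_deriv_nonneg (convex_Ici 0) (by fun_prop) (by fun_prop) fun x hx => ?_
    have h : HasDerivAt (fun x : ℝ => x * Real.cosh x - Real.sinh x) (x * Real.sinh x) x :=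
      (((hasDerivAt_id x).mul (Real.hasDerivAt_cosh x)).sub (Real.hasDerivAt_sinh x)).congr_deriv
        (by simp)
    rw [h.deriv]
    rw [interior_Ici] at hx
    have hx' : 0 ≤ x := le_of_lt hx
    exact mul_nonneg hx' (Real.sinh_nonneg_iff.2 hx')
  have key : ∀ x : ℝ, 0 ≤ x → Real.sinh x ^ 2 ≤ x * (Real.sinh x * Real.cosh x) := by
    intro x hx
    have h := hmono Set.self_mem_Ici hx hx
    simp only [zero_mul, Real.sinh_zero, sub_zero] at h
    nlinarith [mul_nonneg (Real.sinh_nonneg_iff.2 hx) h]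
  rcases le_total 0 x with hx | hx
  · exact key x hx
  · simpa using key (-x) (by linarith)

/-- The entire function `sinh z / z`. -/
def csinhc (z : ℂ) : ℂ := dslope Complex.sinh 0 z

lemma csinhc_of_ne_zero {z : ℂ} (hz : z ≠ 0) : csinhc z = Complex.sinh z / z := by
  rw [csinhc, dslope_of_ne _ hz, slope_def_field]
  simp

lemma csinhc_zero : csinhc 0 = 1 := by
  simp [csinhc]

lemma differentiable_csinhc : Differentiable ℂ csinhc := by
  rw [← differentiableOn_univ]
  exact (Complex.differentiableOn_dslope Filter.univ_mem).2 Complex.differentiable_sinh.differentiableOn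

lemma normSq_sinh (x y : ℝ) :
    Complex.normSq (Complex.sinh (x + y * Complex.I)) = Real.sinh x ^ 2 + Real.sin y ^ 2 := by
  rw [Complex.sinh_add, Complex.sinh_mul_I, Complex.cosh_mul_I, Complex.normSq_apply]
  simp only [← Complex.ofReal_sinh, ← Complex.ofReal_cosh, ← Complex.ofReal_sin,
    ← Complex.ofReal_cos]
  simp only [Complex.add_re, Complex.add_im, Complex.mul_re, Complex.mul_im, Complex.ofReal_re,
    Complex.ofReal_im, Complex.I_re, Complex.I_im, mul_zero, zero_mul, mul_one, sub_zero, add_zero,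
    zero_add]
  linear_combination Real.sin y ^ 2 * Real.cosh_sq x + Real.sinh x ^ 2 * Real.sin_sq_add_cos_sq y

lemma le_normSq_sinh {x y : ℝ} (hy : |y| ≤ 1) :
    Real.exp |x| / 16 * (x ^ 2 + y ^ 2) ≤ Real.sinh x ^ 2 + Real.sin y ^ 2 := by
  have hhalf : |x| * (Real.exp (|x| / 2) / 2) ≤ |Real.sinh x| := by
    rw [Real.abs_sinh]
    have h1 : Real.sinh |x| = 2 * Real.sinh (|x| / 2) * Real.cosh (|x| / 2) := by
      rw [← Real.sinh_two_mul]; congr 1; ring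
    have h2 : |x| / 2 ≤ Real.sinh (|x| / 2) := Real.self_le_sinh_iff.2 (by positivity)
    have h3 : Real.exp (|x| / 2) / 2 ≤ Real.cosh (|x| / 2) := by
      rw [Real.cosh_eq]
      have := Real.exp_pos (-(|x| / 2))
      linarith
    rw [h1]
    have : 0 ≤ |x| := abs_nonneg x
    calc |x| * (Real.exp (|x| / 2) / 2) = 2 * (|x| / 2) * (Real.exp (|x| / 2) / 2) := by ring
      _ ≤ _ := by gcongr
  have hs : x ^ 2 * Real.exp |x| / 4 ≤ Real.sinh x ^ 2 := by
    have h : (|x| * (Real.exp (|x| / 2) / 2)) ^ 2 ≤ |Real.sinh x| ^ 2 := by gcongr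
    rw [sq_abs, mul_pow, div_pow, ← Real.exp_nat_mul, sq_abs] at h
    push_cast at h
    rw [mul_div_cancel₀ _ (two_ne_zero)] at h
    linarith
  have hy2 : y ^ 2 ≤ 1 := by rw [← sq_abs]; exact pow_le_one₀ (abs_nonneg _) hy
  rcases le_total 1 |x| with hx | hx
  · have hx2 : 1 ≤ x ^ 2 := by rw [← sq_abs]; exact one_le_pow₀ hx
    have := mul_le_mul_of_nonneg_left (hy2.trans hx2) (Real.exp_pos |x|).le
    nlinarith [sq_nonneg (Real.sin y), Real.exp_pos |x|, sq_nonneg x]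
  · have hsin : y ^ 2 / 4 ≤ Real.sin y ^ 2 := by
      have h1 : 2 / π * |y| ≤ Real.sin |y| :=
        Real.mul_le_sin (abs_nonneg y) (hy.trans (by linarith [Real.pi_gt_three]))
      have h2 : 1 / 2 * |y| ≤ 2 / π * |y| := by
        gcongr ?_ * _
        rw [div_le_div_iff₀ two_pos Real.pi_pos]
        linarith [Real.pi_le_four]
      have h3 : (1 / 2 * |y|) ^ 2 ≤ Real.sin |y| ^ 2 := by gcongr; linarith
      have h4 : Real.sin |y| ^ 2 = Real.sin y ^ 2 := by
        rcases abs_choice y with h | h <;> rw [h]; simp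
      rw [h4, mul_pow, sq_abs] at h3
      linarith
    have hexp : Real.exp |x| ≤ 3 := by
      have := Real.exp_le_exp.2 hx
      linarith [Real.exp_one_lt_d9]
    nlinarith [sq_nonneg x, sq_nonneg y, Real.exp_pos |x|, Real.add_one_le_exp |x|, abs_nonneg x]

lemma le_norm_csinhc {x y : ℝ} (hy : |y| ≤ 1) :
    Real.exp (|x| / 2) / 4 ≤ ‖csinhc (x + y * Complex.I)‖ := by
  rcases eq_or_ne (x + y * Complex.I : ℂ) 0 with h0 | h0
  · have hx : x = 0 := by simpa using congrArg Complex.re h0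
    rw [h0, csinhc_zero, hx]
    norm_num
  · rw [csinhc_of_ne_zero h0, norm_div, le_div_iff₀ (norm_pos_iff.2 h0)]
    refine le_of_sq_le_sq ?_ (norm_nonneg _)
    rw [mul_pow, ← Complex.normSq_eq_norm_sq, ← Complex.normSq_eq_norm_sq, normSq_sinh,
      Complex.normSq_add_mul_I, div_pow, ← Real.exp_nat_mul]
    refine le_trans (le_of_eq ?_) (le_normSq_sinh hy)
    push_cast
    rw [mul_div_cancel₀ _ (two_ne_zero)]
    norm_num

lemma csinhc_ne_zero {x y : ℝ} (hy : |y| ≤ 1) : csinhc (x + y * Complex.I) ≠ 0 := by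
  rw [← norm_pos_iff]
  exact lt_of_lt_of_le (by positivity) (le_norm_csinhc hy)

lemma mul_sin_sq_le {q y : ℝ} (hy : |y| ≤ 1) (hqy : q ≤ Real.cos y) :
    q * Real.sin y ^ 2 ≤ y * (Real.sin y * Real.cos y) := by
  have key : ∀ y : ℝ, 0 ≤ y → y ≤ 1 → q ≤ Real.cos y →
      q * Real.sin y ^ 2 ≤ y * (Real.sin y * Real.cos y) := by
    intro y hy0 hy hqy
    have h1 : 0 ≤ Real.sin y := Real.sin_nonneg_of_nonneg_of_le_pi hy0
      (by linarith [Real.pi_gt_three])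
    have h2 : 0 ≤ Real.cos y := Real.cos_nonneg_of_mem_Icc
      ⟨by linarith [Real.pi_gt_three], by linarith [Real.pi_gt_three]⟩
    calc q * Real.sin y ^ 2 ≤ Real.cos y * Real.sin y ^ 2 := by gcongr
      _ = Real.sin y * (Real.sin y * Real.cos y) := by ring
      _ ≤ _ := by gcongr; exact Real.sin_le hy0
  rcases le_total 0 y with h | h
  · exact key y h ((le_abs_self y).trans hy) hqy
  · simpa using key (-y) (by linarith) ((neg_le_abs y).trans hy) (by simpa using hqy)

lemma le_re_cosh_div_csinhc {q x y : ℝ} (hq : q < 1) (hy : |y| ≤ 1) (hqy : q ≤ Real.cos y) :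
    q ≤ (Complex.cosh (x + y * Complex.I) / csinhc (x + y * Complex.I)).re := by
  rcases eq_or_ne (x + y * Complex.I : ℂ) 0 with h0 | h0
  · rw [h0, csinhc_zero]
    simpa using hq.le
  · have hns := normSq_sinh x y
    have hpos : 0 < Real.sinh x ^ 2 + Real.sin y ^ 2 := by
      rw [← hns, Complex.normSq_pos]
      intro h
      apply csinhc_ne_zero (x := x) hy
      rw [csinhc_of_ne_zero h0, h, zero_div]
    rw [csinhc_of_ne_zero h0, div_div_eq_mul_div, Complex.div_re, hns, ← add_div,
      le_div_iff₀ hpos]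
    have h1 := sinh_sq_le x
    have h2 : q * Real.sin y ^ 2 ≤ y * (Real.sin y * Real.cos y) := mul_sin_sq_le hy hqy
    have h3 : q * Real.sinh x ^ 2 ≤ Real.sinh x ^ 2 :=
      mul_le_of_le_one_left (sq_nonneg _) hq.le
    rw [Complex.sinh_add, Complex.cosh_add, Complex.sinh_mul_I, Complex.cosh_mul_I]
    simp only [← Complex.ofReal_sinh, ← Complex.ofReal_cosh, ← Complex.ofReal_sin,
      ← Complex.ofReal_cos]
    simp only [Complex.add_re, Complex.add_im, Complex.mul_re, Complex.mul_im, Complex.ofReal_re,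
      Complex.ofReal_im, Complex.I_re, Complex.I_im, mul_zero, zero_mul, mul_one, sub_zero,
      add_zero, zero_add]
    have h4 := Real.cosh_sq x
    have h5 := Real.sin_sq_add_cos_sq y
    refine le_trans (by linarith) (le_of_eq (?_ : x * (Real.sinh x * Real.cosh x) +
      y * (Real.sin y * Real.cos y) = _))
    linear_combination (-(x * Real.sinh x * Real.cosh x)) * h5 -
      y * Real.sin y * Real.cos y * h4

/-- The holomorphic extension of the integrand of the heat kernel. -/
def heatIntegrand (n : ℕ) (a t r : ℝ) (z : ℂ) : ℂ :=
  Complex.exp (-(Complex.I * z * (t : ℂ))) * ((a : ℂ) * csinhc (a * z))⁻¹ ^ n *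
    Complex.exp (-(r / (4 * a) : ℝ) * (Complex.cosh (a * z) / csinhc (a * z)))

lemma heatIntegrand_ofReal {n : ℕ} {a : ℝ} (ha : 0 < a) (t r : ℝ) {x : ℝ} (hx : x ≠ 0) :
    heatIntegrand n a t r x = Complex.exp (-(Complex.I * (x : ℂ) * (t : ℂ))) *
        (((x / Real.sinh (a * x)) ^ n : ℝ) : ℂ) *
        Complex.exp (Complex.ofReal
          (-(x / 4 * (Real.cosh (a * x) / Real.sinh (a * x)) * r))) := by
  have hax : (a * x : ℂ) ≠ 0 := by
    exact_mod_cast mul_ne_zero ha.ne' hx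
  have ha' : (a : ℂ) ≠ 0 := by exact_mod_cast ha.ne'
  have hx' : (x : ℂ) ≠ 0 := by exact_mod_cast hx
  have hs : Complex.sinh (a * x) ≠ 0 := by
    rw [← Complex.ofReal_mul, ← Complex.ofReal_sinh]
    exact_mod_cast Real.sinh_ne_zero.2 (mul_ne_zero ha.ne' hx)
  rw [heatIntegrand, csinhc_of_ne_zero hax]
  push_cast
  congr 2
  · congr 1
    field_simp
  · field_simp

lemma norm_heatIntegrand_le {n : ℕ} (hn : 1 ≤ n) {a q t r x y : ℝ} (ha : 0 < a) (hr : 0 ≤ r)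
    (hq : q < 1) (hy : a * |y| ≤ 1) (hqy : q ≤ Real.cos (a * y)) :
    ‖heatIntegrand n a t r (x + y * Complex.I)‖ ≤
      Real.exp (t * y) * ((4 / a) ^ n * Real.exp (-(a / 2) * |x|)) *
        Real.exp (-(q / (4 * a)) * r) := by
  have hz : (a : ℂ) * (x + y * Complex.I) = ((a * x : ℝ) : ℂ) + ((a * y : ℝ) : ℂ) * Complex.I := by
    push_cast; ring
  have hay : |a * y| ≤ 1 := by rwa [abs_mul, abs_of_pos ha]
  rw [heatIntegrand, norm_mul, norm_mul, hz, norm_pow, norm_inv, norm_mul, Complex.norm_exp,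
    Complex.norm_exp, Complex.norm_real, Real.norm_of_nonneg ha.le]
  gcongr ?_ * ?_ * ?_
  · refine Real.exp_le_exp.2 (le_of_eq ?_)
    simp
    ring
  · have h1 := le_norm_csinhc (x := a * x) hay
    have h2 : a * (Real.exp (|a * x| / 2) / 4) ≤
        a * ‖csinhc (((a * x : ℝ) : ℂ) + ((a * y : ℝ) : ℂ) * Complex.I)‖ := by gcongr
    calc _ ≤ (a * (Real.exp (|a * x| / 2) / 4))⁻¹ ^ n := by gcongr
      _ = (4 / a) ^ n * Real.exp (-(a / 2) * |x|) ^ n := by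
        rw [← mul_pow, abs_mul, abs_of_pos ha, show -(a / 2) * |x| = -(a * |x| / 2) by ring,
          Real.exp_neg]
        congr 1
        field_simp
      _ ≤ _ := by
        gcongr
        refine pow_le_of_le_one (by positivity) ?_ (by omega)
        rw [Real.exp_le_one_iff]
        have : 0 ≤ a / 2 * |x| := by positivity
        linarith
  · have h := le_re_cosh_div_csinhc (x := a * x) hq hay hqy
    rw [← Complex.ofReal_neg, Complex.re_ofReal_mul]
    have h' : r / (4 * a) * q ≤ r / (4 * a) * (Complex.cosh (((a * x : ℝ) : ℂ) +
      ((a * y : ℝ) : ℂ) * Complex.I) / csinhc (((a * x : ℝ) : ℂ) +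
      ((a * y : ℝ) : ℂ) * Complex.I)).re := by gcongr
    refine Real.exp_le_exp.2 ?_
    calc _ ≤ -(r / (4 * a) * q) := by linarith
      _ = _ := by ring

lemma differentiableAt_heatIntegrand (n : ℕ) {a : ℝ} (ha : 0 < a) (t r : ℝ) {z : ℂ}
    (hz : a * |z.im| ≤ 1) : DifferentiableAt ℂ (heatIntegrand n a t r) z := by
  have hc : csinhc (a * z) ≠ 0 := by
    have h := csinhc_ne_zero (x := a * z.re) (y := a * z.im) (by rwa [abs_mul, abs_of_pos ha])
    have : (a * z : ℂ) = ((a * z.re : ℝ) : ℂ) + ((a * z.im : ℝ) : ℂ) * Complex.I := by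
      conv_lhs => rw [← Complex.re_add_im z]
      push_cast; ring
    rwa [this]
  have hd : DifferentiableAt ℂ (fun z : ℂ => csinhc (a * z)) z :=
    (differentiable_csinhc _).comp z (by fun_prop)
  have ha' : (a : ℂ) ≠ 0 := by exact_mod_cast ha.ne'
  unfold heatIntegrand
  refine (DifferentiableAt.mul (by fun_prop) ?_).mul ?_
  · exact ((hd.const_mul _).inv (mul_ne_zero ha' hc)).pow n
  · exact ((DifferentiableAt.div (by fun_prop) hd hc).const_mul _).cexp

/-- The heat kernel decays like a Gaussian in `z` and exponentially in `t`. -/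
lemma exists_norm_heat_integral_le {n : ℕ} (hn : 1 ≤ n) {a q : ℝ} (ha : 0 < a) (hq0 : 0 < q)
    (hq : q < 1) : ∃ η > 0, ∃ M, ∀ t r : ℝ, 0 ≤ r →
      ‖∫ x : ℝ, Complex.exp (-(Complex.I * (x : ℂ) * (t : ℂ))) *
        (((x / Real.sinh (a * x)) ^ n : ℝ) : ℂ) *
        Complex.exp (Complex.ofReal
          (-(x / 4 * (Real.cosh (a * x) / Real.sinh (a * x)) * r)))‖ ≤
      M * Real.exp (-(q / (4 * a)) * r) * Real.exp (-η * |t|) := by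
  set η : ℝ := (1 - q) / a with hη
  have hη0 : 0 < η := div_pos (by linarith) ha
  have haη : a * η = 1 - q := by rw [hη]; field_simp
  have hstrip : ∀ y : ℝ, |y| ≤ η → a * |y| ≤ 1 ∧ q ≤ Real.cos (a * y) := by
    intro y hy
    have h1 : a * |y| ≤ 1 - q := by rw [← haη]; gcongr
    have h2 : (a * y) ^ 2 ≤ (1 - q) ^ 2 := by
      rw [← sq_abs, abs_mul, abs_of_pos ha]
      gcongr
    have h3 := Real.one_sub_sq_div_two_le_cos (x := a * y)
    exact ⟨by linarith, by nlinarith⟩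
  refine ⟨η, hη0, ∫ x : ℝ, (4 / a) ^ n * Real.exp (-(a / 2) * |x|), fun t r hr => ?_⟩
  have hae : (fun x : ℝ => Complex.exp (-(Complex.I * (x : ℂ) * (t : ℂ))) *
        (((x / Real.sinh (a * x)) ^ n : ℝ) : ℂ) *
        Complex.exp (Complex.ofReal
          (-(x / 4 * (Real.cosh (a * x) / Real.sinh (a * x)) * r)))) =ᵐ[volume]
      fun x : ℝ => heatIntegrand n a t r x := by
    have : ∀ᵐ x : ℝ, x ≠ 0 := by simp [ae_iff, measure_singleton]
    filter_upwards [this] with x hx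
    exact (heatIntegrand_ofReal ha t r hx).symm
  rw [integral_congr_ae hae]
  obtain ⟨σ, hσ, hσt⟩ : ∃ σ : ℝ, |σ| = η ∧ t * σ = -η * |t| := by
    rcases le_total 0 t with h | h
    · exact ⟨-η, by rw [abs_neg, abs_of_pos hη0], by rw [abs_of_nonneg h]; ring⟩
    · exact ⟨η, abs_of_pos hη0, by rw [abs_of_nonpos h]; ring⟩
  have hint := (integrable_exp_neg_mul_abs (c := a / 2) (by positivity)).const_mul ((4 / a) ^ n)
  have hlim : ∀ l : Filter ℝ, Tendsto (fun x : ℝ => |x|) l atTop → Tendsto (fun x : ℝ =>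
      Real.exp (|t| * η) * ((4 / a) ^ n * Real.exp (-(a / 2) * |x|)) *
        Real.exp (-(q / (4 * a)) * r)) l (nhds 0) := by
    intro l hl
    have h := Real.tendsto_exp_atBot.comp (hl.const_mul_atTop_of_neg (r := -(a / 2)) (by linarith))
    simpa using ((h.const_mul ((4 / a) ^ n)).const_mul (Real.exp (|t| * η))).mul_const
      (Real.exp (-(q / (4 * a)) * r))
  rw [integral_add_mul_I_eq_of_norm_le (η := σ) (B := fun x =>
    Real.exp (|t| * η) * ((4 / a) ^ n * Real.exp (-(a / 2) * |x|)) *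
      Real.exp (-(q / (4 * a)) * r)) ?_ ?_ ((hint.const_mul _).mul_const _)
    (hlim _ tendsto_abs_atTop_atTop) (hlim _ tendsto_abs_atBot_atTop)]
  · refine (norm_integral_le_of_norm_le ((hint.const_mul (Real.exp (t * σ))).mul_const
      (Real.exp (-(q / (4 * a)) * r))) (ae_of_all _ fun x =>
        norm_heatIntegrand_le hn ha hr hq (hstrip σ hσ.le).1 (hstrip σ hσ.le).2)).trans
      (le_of_eq ?_)
    rw [integral_mul_const, integral_const_mul, hσt]
    ring
  · intro z hz
    exact (differentiableAt_heatIntegrand n ha t r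
      (hstrip z.im (by rw [← hσ]; exact hz)).1).differentiableWithinAt
  · intro x y hy
    rw [hσ] at hy
    refine (norm_heatIntegrand_le hn ha hr hq (hstrip y hy).1 (hstrip y hy).2).trans ?_
    gcongr ?_ * _ * _
    refine Real.exp_le_exp.2 ?_
    calc t * y ≤ |t| * |y| := by rw [← abs_mul]; exact le_abs_self _
      _ ≤ _ := by gcongr

end HeatKernel

section FourierUniqueness

lemma norm_cexp_I_mul_le {η ε t : ℝ} {x : ℂ} (hx : |x.im| ≤ η - ε) :
    ‖Complex.exp (Complex.I * x * t)‖ ≤ Real.exp ((η - ε) * |t|) := by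
  rw [Complex.norm_exp, mul_comm Complex.I x, Complex.re_mul_ofReal, Complex.mul_I_re]
  refine Real.exp_le_exp.2 ?_
  calc -x.im * t ≤ |x.im| * |t| := by rw [← abs_neg x.im, ← abs_mul]; exact le_abs_self _
    _ ≤ _ := by gcongr

lemma differentiableAt_integral_cexp_mul {h : ℝ → ℂ} (hh : AEStronglyMeasurable h) {M η : ℝ}
    (hM : ∀ t, ‖h t‖ ≤ M * Real.exp (-η * |t|)) {s : ℂ} (hs : |s.im| < η) :
    DifferentiableAt ℂ (fun s : ℂ => ∫ t : ℝ, Complex.exp (Complex.I * s * t) * h t) s := by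
  set ε := (η - |s.im|) / 2 with hε
  have hε0 : 0 < ε := by rw [hε]; linarith
  have hmeas : ∀ x : ℂ, AEStronglyMeasurable fun t : ℝ => Complex.exp (Complex.I * x * t) * h t :=
    fun x => (by fun_prop : Continuous fun t : ℝ =>
      Complex.exp (Complex.I * x * t)).aestronglyMeasurable.mul hh
  have hM0 : 0 ≤ M := by simpa using (norm_nonneg _).trans (hM 0)
  refine (hasDerivAt_integral_of_dominated_loc_of_deriv_le
    (F' := fun s t => Complex.exp (Complex.I * s * t) * (Complex.I * t) * h t)
    (bound := fun t => M * (2 / ε) * Real.exp (-(ε / 2) * |t|))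
    (Metric.ball_mem_nhds s hε0) (Eventually.of_forall hmeas) ?_ ?_
    (ae_of_all _ fun t x hx => ?_)
    ((integrable_exp_neg_mul_abs (by positivity)).const_mul _)
    (ae_of_all _ fun t x hx => ?_)).2.differentiableAt
  · refine ((integrable_exp_neg_mul_abs hε0).const_mul M).mono' (hmeas s) (ae_of_all _ fun t => ?_)
    rw [norm_mul]
    calc _ ≤ Real.exp ((η - ε) * |t|) * (M * Real.exp (-η * |t|)) := by
          gcongr
          · exact norm_cexp_I_mul_le (by linarith)
          · exact hM t
      _ = M * (Real.exp ((η - ε) * |t|) * Real.exp (-η * |t|)) := by ring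
      _ = _ := by rw [← Real.exp_add]; congr 2; ring
  · exact (by fun_prop : Continuous fun t : ℝ =>
      Complex.exp (Complex.I * s * t) * (Complex.I * t)).aestronglyMeasurable.mul hh
  · have hx' : |x.im| ≤ η - ε := by
      have h1 : |(x - s).im| < ε := (Complex.abs_im_le_norm _).trans_lt (by
        simpa [dist_eq_norm] using hx)
      rw [Complex.sub_im] at h1
      have h2 := abs_sub_abs_le_abs_sub x.im s.im
      linarith
    have ht : |t| ≤ (2 / ε) * Real.exp (ε / 2 * |t|) := by
      have := Real.add_one_le_exp (ε / 2 * |t|)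
      calc |t| = (2 / ε) * (ε / 2 * |t|) := by field_simp
        _ ≤ _ := by gcongr; linarith
    rw [norm_mul, norm_mul, norm_mul, Complex.norm_I, one_mul, Complex.norm_real, Real.norm_eq_abs]
    calc _ ≤ Real.exp ((η - ε) * |t|) * ((2 / ε) * Real.exp (ε / 2 * |t|)) *
          (M * Real.exp (-η * |t|)) := by
          gcongr
          · exact norm_cexp_I_mul_le hx'
          · exact hM t
      _ = M * (2 / ε) * (Real.exp ((η - ε) * |t|) * Real.exp (ε / 2 * |t|) *
          Real.exp (-η * |t|)) := by ring
      _ = _ := by rw [← Real.exp_add, ← Real.exp_add]; congr 2; ring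
  · have h1 : HasDerivAt (fun s : ℂ => Complex.I * s * (t : ℂ)) (Complex.I * t) x := by
      simpa using ((hasDerivAt_id x).const_mul Complex.I).mul_const (t : ℂ)
    exact h1.cexp.mul_const _

open scoped FourierTransform RealInnerProductSpace in
/-- An integrable function with vanishing Fourier transform vanishes almost everywhere. -/
lemma ae_eq_zero_of_integral_cexp_eq_zero {h : ℝ → ℂ} (hh : Integrable h)
    (h0 : ∀ s : ℝ, ∫ t : ℝ, Complex.exp (Complex.I * s * t) * h t = 0) : h =ᵐ[volume] 0 := by
  have hF : ∀ w : ℝ, 𝓕 h w = 0 := by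
    intro w
    rw [Real.fourier_real_eq_integral_exp_smul, ← h0 (-2 * π * w)]
    refine integral_congr_ae (ae_of_all _ fun t => ?_)
    simp only [smul_eq_mul]
    congr 2
    push_cast
    ring
  refine ae_eq_zero_of_integral_contDiff_smul_eq_zero hh.locallyIntegrable fun χ hχ hχs => ?_
  set φ : SchwartzMap ℝ ℂ := (hχs.comp_left (g := Complex.ofReal) (by simp)).toSchwartzMap
    (Complex.ofRealCLM.contDiff.comp hχ) with hφ
  have hφχ : ∀ x, φ x = (χ x : ℂ) := fun x => rfl
  have key := VectorFourier.integral_fourierIntegral_smul_eq_flip (L := innerₗ ℝ)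
    (μ := volume) (ν := volume) (f := (𝓕⁻ φ : SchwartzMap ℝ ℂ)) (g := h)
    Real.continuous_fourierChar continuous_inner (𝓕⁻ φ : SchwartzMap ℝ ℂ).integrable hh
  have h1 : ∀ ξ, VectorFourier.fourierIntegral Real.fourierChar volume (innerₗ ℝ)
      (𝓕⁻ φ : SchwartzMap ℝ ℂ) ξ = φ ξ := by
    intro ξ
    have : 𝓕 (𝓕⁻ φ : SchwartzMap ℝ ℂ) = φ := FourierTransform.fourier_fourierInv_eq φ
    conv_rhs => rw [← this]
    rw [SchwartzMap.fourier_coe]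
    rfl
  have h2 : ∀ x, VectorFourier.fourierIntegral Real.fourierChar volume (innerₗ ℝ).flip h x = 0 := by
    intro x
    rw [flip_innerₗ]
    exact hF x
  simp only [h1, h2, smul_zero, integral_zero, hφχ] at key
  simpa using key

lemma ae_eq_zero_of_frequently_integral_cexp_eq_zero {h : ℝ → ℂ} (hh : AEStronglyMeasurable h)
    {M η : ℝ} (hη : 0 < η) (hM : ∀ t, ‖h t‖ ≤ M * Real.exp (-η * |t|))
    (h0 : ∃ᶠ s in nhdsWithin (0 : ℂ) {0}ᶜ, ∫ t : ℝ, Complex.exp (Complex.I * s * t) * h t = 0) :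
    h =ᵐ[volume] 0 := by
  set U : Set ℂ := {z | |z.im| < η} with hU
  have hUo : IsOpen U := isOpen_lt (by fun_prop) continuous_const
  have hUc : IsPreconnected U := by
    have : U = Complex.imCLM ⁻¹' (Set.Ioo (-η) η) := by
      ext z; simp [hU, abs_lt]
    rw [this]
    exact ((convex_Ioo (-η) η).linear_preimage (Complex.imCLM : ℂ →ₗ[ℝ] ℝ)).isPreconnected
  have hd : DifferentiableOn ℂ
      (fun s : ℂ => ∫ t : ℝ, Complex.exp (Complex.I * s * t) * h t) U := fun s hs =>
    (differentiableAt_integral_cexp_mul hh hM hs).differentiableWithinAt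
  have hz := (hd.analyticOnNhd hUo).eqOn_zero_of_preconnected_of_frequently_eq_zero hUc
    (z₀ := 0) (by simpa [hU] using hη) h0
  refine ae_eq_zero_of_integral_cexp_eq_zero
    (((integrable_exp_neg_mul_abs hη).const_mul M).mono' hh (ae_of_all _ hM)) fun s => ?_
  exact hz (x := (s : ℂ)) (by simpa [hU] using hη)

end FourierUniqueness

section HardyTheorem

lemma aestronglyMeasurable_fLam {n : ℕ} {f : Hn n → ℂ}
    (hf : AEStronglyMeasurable f (volume : Measure (Hn n))) (lam : ℝ) :
    AEStronglyMeasurable (fLam n f lam) := by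
  refine AEStronglyMeasurable.integral_prod_right'
    (f := fun p : Cn n × ℝ => Complex.exp (Complex.I * (lam : ℂ) * (p.2 : ℂ)) * f p) ?_
  exact (by fun_prop : Continuous fun p : Cn n × ℝ =>
    Complex.exp (Complex.I * (lam : ℂ) * (p.2 : ℂ))).aestronglyMeasurable.mul hf

lemma norm_fLam_le {n : ℕ} {f : Hn n → ℂ} {M κ η : ℝ} (hη : 0 < η)
    (hM : ∀ z t, ‖f (z, t)‖ ≤ M * Real.exp (-κ * ‖z‖ ^ 2) * Real.exp (-η * |t|)) (lam : ℝ)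
    (z : Cn n) :
    ‖fLam n f lam z‖ ≤ (M * ∫ t : ℝ, Real.exp (-η * |t|)) * Real.exp (-κ * ‖z‖ ^ 2) := by
  refine (norm_integral_le_of_norm_le ((integrable_exp_neg_mul_abs hη).const_mul
    (M * Real.exp (-κ * ‖z‖ ^ 2))) (ae_of_all _ fun t => ?_)).trans (le_of_eq ?_)
  · have : Complex.I * (lam : ℂ) * (t : ℂ) = ((lam * t : ℝ) : ℂ) * Complex.I := by
      push_cast; ring
    rw [norm_mul, this, Complex.norm_exp_ofReal_mul_I, one_mul]
    exact hM z t
  · rw [integral_const_mul]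
    ring

/-- Hardy's theorem under explicit decay bounds. -/
lemma ae_eq_zero_of_stri_le {d : ℕ} {f : Hn (d + 1) → ℂ}
    (hf : Integrable f (volume : Measure (Hn (d + 1)))) {M κ κ' η b b' C : ℝ} (hη : 0 < η)
    (hM : ∀ z t, ‖f (z, t)‖ ≤ M * Real.exp (-κ * ‖z‖ ^ 2) * Real.exp (-η * |t|))
    (hb' : 0 < b') (hb : b' < b) (hκ : κ' < κ) (hκb : 1 / b' < 4 * κ')
    (h2 : ∀ lam : ℝ, lam ≠ 0 → ∀ k : ℕ,
      |lam| ^ (d + 1) * ∫ z, ‖stri (d + 1) f k lam z‖ ^ 2 ≤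
        C * ((k + d).choose d : ℝ) * Real.exp (-(2 * b * (2 * k + (d + 1)) * |lam|))) :
    f =ᵐ[(volume : Measure (Hn (d + 1)))] 0 := by
  set δ : ℝ := 4 * κ' - 1 / b' with hδ
  have hδ0 : 0 < δ := by linarith
  have hzero : ∀ lam : ℝ, 0 < lam → lam < δ → fLam (d + 1) f (-lam) =ᵐ[volume] 0 := by
    intro lam hlam hlamδ
    refine ae_eq_zero_of_twConv_lagFun_le (A := (|lam| ^ (d + 1))⁻¹ * C) d hlam.ne'
      (aestronglyMeasurable_fLam hf.aestronglyMeasurable _) hb' hb hκ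
      (by rw [abs_of_pos hlam]; linarith) (norm_fLam_le hη hM _) fun k => ?_
    have h := h2 lam hlam.ne' k
    have hpos : 0 < |lam| ^ (d + 1) := by positivity
    rw [mul_assoc, mul_assoc, le_inv_mul_iff₀ hpos, ← mul_assoc]
    exact h
  set u : ℕ → ℝ := fun j => δ / 2 * (1 / ((j : ℝ) + 1)) with hu
  have hu0 : ∀ j, 0 < u j := fun j => by positivity
  have huδ : ∀ j, u j < δ := fun j => by
    have h1 : 1 / ((j : ℝ) + 1) ≤ 1 := by
      rw [div_le_one (by positivity)]
      linarith [(Nat.cast_nonneg j : (0 : ℝ) ≤ j)]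
    have h3 : u j ≤ δ / 2 := mul_le_of_le_one_right (by positivity) h1
    linarith
  have hulim : Tendsto (fun j => ((-u j : ℝ) : ℂ)) atTop (nhdsWithin 0 {0}ᶜ) := by
    refine tendsto_nhdsWithin_iff.2 ⟨?_, Eventually.of_forall fun j => ?_⟩
    · have h : Tendsto u atTop (nhds 0) := by
        have h' := (tendsto_one_div_add_atTop_nhds_zero_nat (𝕜 := ℝ)).const_mul (δ / 2)
        rwa [mul_zero] at h'
      have h2 : Tendsto (fun j => -u j) atTop (nhds 0) := by
        have h' := h.neg
        rwa [neg_zero] at h'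
      have h3 := (Complex.continuous_ofReal.tendsto 0).comp h2
      rwa [Complex.ofReal_zero] at h3
    · simpa using (hu0 j).ne'
  have hfib : ∀ᵐ z : Cn (d + 1), (fun t => f (z, t)) =ᵐ[volume] 0 := by
    have hall : ∀ᵐ z : Cn (d + 1), ∀ j, fLam (d + 1) f (-u j) z = 0 :=
      ae_all_iff.2 fun j => hzero (u j) (hu0 j) (huδ j)
    filter_upwards [hall, hf.aestronglyMeasurable.prodMk_left] with z hz hzm
    exact ae_eq_zero_of_frequently_integral_cexp_eq_zero hzm hη (hM z)
      (hulim.frequently (Frequently.of_forall hz))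
  have hint : ∫ x, ‖f x‖ = 0 := by
    rw [Measure.volume_eq_prod, integral_prod _ hf.norm]
    refine integral_eq_zero_of_ae ?_
    filter_upwards [hfib] with z hz
    refine integral_eq_zero_of_ae ?_
    filter_upwards [hz] with t ht
    simpa using ht
  rw [integral_eq_zero_iff_of_nonneg (fun x => norm_nonneg _) hf.norm] at hint
  filter_upwards [hint] with x hx
  simpa using hx

end HardyTheorem

/-- **Hardy's uncertainty principle for the Strichartz Fourier transform**: if
|f(z,t)| ≤ C p_a(z,t) and |λ|^n ∫|f̂(a,z)|²dz ≤ C ((k+n−1)!/(k!(n−1)!)) e^{−2b(2k+n)|λ|}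
with a < b, then f = 0. -/
theorem strichartz_hardy (n : ℕ) (hn : 1 ≤ n) (a b : ℝ) (ha : 0 < a) (hb : 0 < b)
    (hab : a < b) (f : Hn n → ℂ) (hf : Integrable f (volume : Measure (Hn n)))
    (C : ℝ) (hC : 0 < C)
    (h1 : ∀ x : Hn n, ‖f x‖ ≤ C * ((((2 * π) ^ (n + 1))⁻¹ : ℝ) *
      (∫ lam : ℝ, Complex.exp (-(Complex.I * (lam : ℂ) * (x.2 : ℂ))) *
        (((lam / Real.sinh (a * lam)) ^ n : ℝ) : ℂ) *
        Complex.exp (Complex.ofReal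
          (-(lam / 4 * (Real.cosh (a * lam) / Real.sinh (a * lam)) * ‖x.1‖ ^ 2)))).re))
    (h2 : ∀ lam : ℝ, lam ≠ 0 → ∀ k : ℕ,
      |lam| ^ n * ∫ z : Cn n, ‖stri n f k lam z‖ ^ 2 ≤
        C * (((k + n - 1).factorial : ℝ) / ((Nat.factorial k) * (Nat.factorial (n - 1)))) *
          Real.exp (-(2 * b * (2 * k + n) * |lam|))) :
    f =ᵐ[(volume : Measure (Hn n))] 0 := by
  obtain ⟨d, rfl⟩ : ∃ d, n = d + 1 := ⟨n - 1, by omega⟩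
  set a₁ := a + (b - a) / 4 with ha₁
  set a₂ := a + (b - a) / 2 with ha₂
  set b' := a + 3 * (b - a) / 4 with hb'
  have ha₁0 : 0 < a₁ := by linarith
  have ha₂0 : 0 < a₂ := by linarith
  have hb'0 : 0 < b' := by linarith
  obtain ⟨η, hη, M, hM⟩ := exists_norm_heat_integral_le hn ha (q := a / a₁) (by positivity)
    ((div_lt_one ha₁0).2 (by linarith))
  refine ae_eq_zero_of_stri_le (κ := 1 / (4 * a₁)) (κ' := 1 / (4 * a₂)) (b := b) (b' := b')
    (M := C * (((2 * π) ^ (d + 1 + 1))⁻¹ * M)) (C := C) hf hη (fun z t => ?_) hb'0 (by linarith)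
    ?_ ?_ fun lam hlam k => ?_
  · refine (h1 (z, t)).trans ?_
    rw [mul_assoc C, mul_assoc C, mul_assoc _ M, mul_assoc _ (M * _)]
    gcongr
    refine (Complex.re_le_norm _).trans ((hM t (‖z‖ ^ 2) (by positivity)).trans (le_of_eq ?_))
    congr 4
    field_simp
  · gcongr
    linarith
  · rw [show 4 * (1 / (4 * a₂)) = 1 / a₂ by field_simp]
    gcongr
    linarith
  · have h := h2 lam hlam k
    have hc : (((k + (d + 1) - 1).factorial : ℝ) / (k.factorial * (d + 1 - 1).factorial)) =
        ((k + d).choose d : ℝ) := by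
      rw [Nat.choose_symm_add.symm, Nat.cast_add_choose]
      rfl
    rw [hc] at h
    push_cast at h
    exact h
end
end

section
/- For every f ∈ L¹(ℍⁿ) and every λ ≠ 0, one has sup_{k ∈ ℕ, z ∈ ℂⁿ} |f̃((λ,(2k+n)|λ|), z)| ≤ ∫_{ℂⁿ} |f^{−λ}(w)| dw, and consequently f̃((λ,(2k+n)|λ|), z) → 0 as |λ| → ∞, uniformly in k ∈ ℕ and z ∈ ℂⁿ. -/
open MeasureTheory Complex Real Filter

noncomputable section

/-- The monic Charlier polynomial of degree `k` with parameter `t`, evaluated at `m`. -/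
def charlier (t : ℝ) (k m : ℕ) : ℝ :=
  ∑ ij ∈ Finset.HasAntidiagonal.antidiagonal k, (k.choose ij.1 : ℝ) * ((-t) ^ ij.2 * (m.descFactorial ij.1 : ℝ))

lemma charlier_zero (t : ℝ) (m : ℕ) : charlier t 0 m = 1 := by
  simp [charlier]

lemma charlier_succ (t : ℝ) (k m : ℕ) :
    charlier t (k + 1) m = m * charlier t k (m - 1) - t * charlier t k m := by
  unfold charlier
  rw [Finset.sum_antidiagonal_choose_succ_mul
    (fun i j => (-t) ^ j * (m.descFactorial i : ℝ)) k, Finset.mul_sum, Finset.mul_sum, add_comm,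
    sub_eq_add_neg, ← Finset.sum_neg_distrib]
  congr 1
  · refine Finset.sum_congr rfl fun ij hij => ?_
    rw [Nat.choose_symm_of_eq_add (Finset.HasAntidiagonal.mem_antidiagonal.1 hij).symm]
    rcases m with _ | m
    · simp
    · rw [Nat.succ_descFactorial_succ]
      push_cast
      ring
  · refine Finset.sum_congr rfl fun ij _ => ?_
    ring

lemma charlier_succ_sub (t : ℝ) (k m : ℕ) :
    charlier t (k + 1) (m + 1) - charlier t (k + 1) m = (k + 1) * charlier t k m := by
  induction k generalizing m with
  | zero => simp [charlier_succ, charlier_zero]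
  | succ k ih =>
    rw [charlier_succ t (k + 1) (m + 1), charlier_succ t (k + 1) m]
    have h := ih m
    have hr := charlier_succ t k m
    rcases m with _ | m
    · simp only [Nat.add_sub_cancel] at *
      push_cast at *
      linear_combination (-t) * h - (k + 1) * hr
    · have h' := ih m
      simp only [Nat.add_sub_cancel] at *
      push_cast at *
      linear_combination (-t) * h + (m + 1) * h' - (k + 1) * hr

lemma abs_charlier_le {t : ℝ} (ht : 0 ≤ t) (k m : ℕ) : |charlier t k m| ≤ (m + t) ^ k := by
  induction k generalizing m with
  | zero => simp [charlier_zero]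
  | succ k ih =>
    have hpred : |charlier t k (m - 1)| ≤ (m + t) ^ k :=
      (ih _).trans (by gcongr; exact Nat.sub_le m 1)
    calc |charlier t (k + 1) m|
        ≤ |m * charlier t k (m - 1)| + |t * charlier t k m| := by
          rw [charlier_succ]; exact abs_sub _ _
      _ = m * |charlier t k (m - 1)| + t * |charlier t k m| := by
          rw [abs_mul, abs_mul, abs_of_nonneg ht, Nat.abs_cast]
      _ ≤ m * (m + t) ^ k + t * (m + t) ^ k := by gcongr; exact ih m
      _ = (m + t) ^ (k + 1) := by ring

lemma summable_poisson_mul_pow {t : ℝ} (ht : 0 ≤ t) (k : ℕ) :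
    Summable fun m : ℕ => t ^ m / m.factorial * (m + t) ^ k := by
  refine Summable.of_nonneg_of_le (fun m => by positivity) (fun m => ?_)
    ((Real.summable_pow_div_factorial (t * Real.exp 1)).mul_left (k.factorial * Real.exp t))
  have h := Real.pow_div_factorial_le_exp (x := m + t) (by positivity) k
  rw [div_le_iff₀ (by positivity)] at h
  calc t ^ m / m.factorial * (m + t) ^ k
      ≤ t ^ m / m.factorial * (Real.exp (m + t) * k.factorial) := by gcongr
    _ = k.factorial * Real.exp t * ((t * Real.exp 1) ^ m / m.factorial) := by
        rw [Real.exp_add, mul_pow, ← Real.exp_nat_mul, mul_one]; ring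

/-- The squared norms of the Charlier polynomials in `ℓ²` of the Poisson weight. -/
lemma hasSum_charlier_sq {t : ℝ} (ht : 0 ≤ t) (k : ℕ) :
    HasSum (fun m : ℕ => t ^ m / m.factorial * charlier t k m ^ 2)
      (Real.exp t * t ^ k * k.factorial) := by
  induction k with
  | zero =>
    simp only [charlier_zero, one_pow, mul_one, pow_zero, Nat.factorial_zero, Nat.cast_one]
    rw [Real.exp_eq_exp_ℝ]
    exact NormedSpace.expSeries_div_hasSum_exp t
  | succ k ih =>
    have hb : Summable fun m : ℕ =>
        t ^ m / m.factorial * (charlier t k m * charlier t (k + 1) m) := by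
      refine Summable.of_norm_bounded (summable_poisson_mul_pow ht (k + (k + 1))) fun m => ?_
      rw [Real.norm_eq_abs, abs_mul, abs_mul, abs_of_nonneg (by positivity), pow_add]
      gcongr
      · exact abs_charlier_le ht k m
      · exact abs_charlier_le ht (k + 1) m
    have hB := hb.hasSum.mul_left t
    have hshift : HasSum (fun m : ℕ => t ^ (m + 1) / (m + 1).factorial *
        ((m + 1 : ℕ) * charlier t k m * charlier t (k + 1) (m + 1))) _ :=
      (hB.add (ih.mul_left (t * (k + 1)))).congr_fun fun m => by
        have h := charlier_succ_sub t k m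
        have hm : ((m : ℝ) + 1) ≠ 0 := by positivity
        rw [sub_eq_iff_eq_add] at h
        rw [h, Nat.factorial_succ]
        push_cast
        field_simp
        ring
    have hA := HasSum.zero_add (f := fun m : ℕ => t ^ m / m.factorial *
      (m * charlier t k (m - 1) * charlier t (k + 1) m)) hshift
    convert! hA.sub hB using 1
    · funext m
      simp only [charlier_succ t k m]
      ring
    · rw [Nat.factorial_succ]
      push_cast
      simp
      ring

lemma charlier_self (t : ℝ) (k : ℕ) : charlier t k k = k.factorial * lagPoly 1 k t := by
  unfold charlier lagPoly
  rw [← Finset.Nat.sum_antidiagonal_swap, Finset.Nat.sum_antidiagonal_eq_sum_range_succ_mk,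
    Finset.mul_sum]
  refine Finset.sum_congr rfl fun j hj => ?_
  have hjk : j ≤ k := by simpa [Nat.lt_succ_iff] using hj
  have h := Nat.factorial_mul_descFactorial (Nat.sub_le k j)
  rw [Nat.sub_sub_self hjk] at h
  have h' : (k.factorial : ℝ) = j.factorial * k.descFactorial (k - j) := by exact_mod_cast h.symm
  have hj0 : (j.factorial : ℝ) ≠ 0 := by positivity
  simp only [Prod.fst_swap, Prod.snd_swap, Nat.add_sub_cancel]
  rw [h']
  field_simp

lemma abs_lagPoly_one_le {t : ℝ} (ht : 0 ≤ t) (k : ℕ) :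
    |lagPoly 1 k t| ≤ Real.exp (t / 2) := by
  rcases ht.eq_or_lt with rfl | ht
  · have h : lagPoly 1 k 0 = 1 := by
      unfold lagPoly
      rw [Finset.sum_eq_single 0] <;> simp +contextual
    simp [h]
  refine abs_le_of_sq_le_sq ?_ (Real.exp_pos _).le
  have h := le_hasSum (hasSum_charlier_sq ht.le k) k fun m _ => by positivity
  rw [charlier_self] at h
  have hc : 0 < t ^ k * (k.factorial : ℝ) := by positivity
  have hk : (k.factorial : ℝ) ≠ 0 := by positivity
  rw [← Real.exp_nat_mul, show ((2 : ℕ) : ℝ) * (t / 2) = t by push_cast; ring]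
  refine le_of_mul_le_mul_left ?_ hc
  calc t ^ k * (k.factorial : ℝ) * lagPoly 1 k t ^ 2
      = t ^ k / k.factorial * (k.factorial * lagPoly 1 k t) ^ 2 := by field_simp
    _ ≤ _ := h
    _ = _ := by ring

lemma lagPoly_zero_right (m : ℕ) (t : ℝ) : lagPoly m 0 t = 1 := by
  simp [lagPoly]

lemma lagPoly_succ_succ {m : ℕ} (hm : 1 ≤ m) (k : ℕ) (t : ℝ) :
    lagPoly (m + 1) (k + 1) t = lagPoly (m + 1) k t + lagPoly m (k + 1) t := by
  unfold lagPoly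
  rw [Finset.sum_range_succ _ (k + 1), Finset.sum_range_succ _ (k + 1), ← add_assoc (Finset.sum _ _),
    ← Finset.sum_add_distrib]
  congr 1
  · refine Finset.sum_congr rfl fun j hj => ?_
    have hjk : j ≤ k := by simpa [Nat.lt_succ_iff] using hj
    have h : (k + 1 + (m + 1) - 1).choose (k + 1 - j) =
        (k + (m + 1) - 1).choose (k - j) + (k + 1 + m - 1).choose (k + 1 - j) := by
      rw [show k + 1 + (m + 1) - 1 = (k + m) + 1 by omega, show k + 1 - j = (k - j) + 1 by omega,
        show k + (m + 1) - 1 = k + m by omega, show k + 1 + m - 1 = k + m by omega,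
        Nat.choose_succ_succ]
    rw [h]
    push_cast
    ring
  · simp

/-- The classical bound of a Laguerre polynomial of type `m - 1` by its value at the origin. -/
lemma abs_lagPoly_le_s19 {m : ℕ} (hm : 1 ≤ m) (k : ℕ) {t : ℝ} (ht : 0 ≤ t) :
    |lagPoly m k t| ≤ (k + m - 1).choose k * Real.exp (t / 2) := by
  induction m, hm using Nat.le_induction generalizing k with
  | base => simpa using abs_lagPoly_one_le ht k
  | succ m hm ih =>
    induction k with
    | zero => simpa [lagPoly_zero_right] using div_nonneg ht zero_le_two
    | succ k ihk =>
      have h : (k + 1 + (m + 1) - 1).choose (k + 1) =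
          (k + (m + 1) - 1).choose k + (k + 1 + m - 1).choose (k + 1) := by
        rw [show k + 1 + (m + 1) - 1 = (k + m) + 1 by omega,
          show k + (m + 1) - 1 = k + m by omega, show k + 1 + m - 1 = k + m by omega,
          Nat.choose_succ_succ]
      rw [lagPoly_succ_succ hm, h]
      push_cast
      rw [add_mul]
      exact (abs_add_le _ _).trans (add_le_add ihk (ih (k + 1)))

lemma normC_nonneg (n k : ℕ) : 0 ≤ normC n k := by
  unfold normC; positivity

lemma normC_mul_choose {n : ℕ} (hn : 1 ≤ n) (k : ℕ) :
    normC n k * (k + n - 1).choose k = 1 := by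
  have h := Nat.choose_mul_factorial_mul_factorial (show k ≤ k + n - 1 by omega)
  rw [show k + n - 1 - k = n - 1 by omega] at h
  unfold normC
  rw [div_mul_eq_mul_div, div_eq_one_iff_eq (by positivity), ← h]
  push_cast
  ring

lemma normC_mul_abs_lagFun_le {n : ℕ} (hn : 1 ≤ n) (k : ℕ) (lam : ℝ) (z : Cn n) :
    normC n k * |lagFun n k lam z| ≤ 1 := by
  have h := abs_lagPoly_le_s19 hn k (t := |lam| * ‖z‖ ^ 2 / 2) (by positivity)
  rw [lagFun, abs_mul, Real.abs_exp]
  calc normC n k * (|lagPoly n k (|lam| * ‖z‖ ^ 2 / 2)| * Real.exp (-(|lam| * ‖z‖ ^ 2 / 4)))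
      ≤ normC n k * (((k + n - 1).choose k * Real.exp (|lam| * ‖z‖ ^ 2 / 2 / 2)) *
          Real.exp (-(|lam| * ‖z‖ ^ 2 / 4))) := by
        gcongr
        exact normC_nonneg n k
    _ = normC n k * (k + n - 1).choose k *
          Real.exp (|lam| * ‖z‖ ^ 2 / 2 / 2 + -(|lam| * ‖z‖ ^ 2 / 4)) := by
        rw [Real.exp_add]; ring
    _ = 1 := by
        rw [normC_mul_choose hn, show |lam| * ‖z‖ ^ 2 / 2 / 2 + -(|lam| * ‖z‖ ^ 2 / 4) = 0 by ring]
        simp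

lemma norm_exp_I_mul_mul (a b : ℝ) : ‖Complex.exp (Complex.I * (a : ℂ) * (b : ℂ))‖ = 1 := by
  rw [show Complex.I * (a : ℂ) * (b : ℂ) = ((a * b : ℝ) : ℂ) * Complex.I by push_cast; ring]
  exact Complex.norm_exp_ofReal_mul_I _

section Fibre

variable {n : ℕ} {f : Hn n → ℂ}

lemma integrable_exp_mul (hf : Integrable f) (lam : ℝ) :
    Integrable fun x : Hn n => Complex.exp (Complex.I * (lam : ℂ) * (x.2 : ℂ)) * f x := by
  refine hf.bdd_mul (c := 1) (Continuous.aestronglyMeasurable (by fun_prop)) ?_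
  exact Eventually.of_forall fun x => (norm_exp_I_mul_mul lam x.2).le

lemma integrable_fLam (hf : Integrable f) (lam : ℝ) : Integrable (fLam n f lam) :=
  (integrable_exp_mul hf lam).integral_prod_left

lemma norm_fLam_le_s19 (lam : ℝ) (z : Cn n) : ‖fLam n f lam z‖ ≤ ∫ t : ℝ, ‖f (z, t)‖ := by
  refine (norm_integral_le_integral_norm _).trans_eq ?_
  simp only [norm_mul, norm_exp_I_mul_mul, one_mul]

lemma tendsto_fLam_cobounded (z : Cn n) :
    Tendsto (fun lam : ℝ => fLam n f lam z) (Bornology.cobounded ℝ) (nhds 0) := by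
  have hscale : Tendsto (fun lam : ℝ => -lam / (2 * π)) (Bornology.cobounded ℝ)
      (cocompact ℝ) := by
    rw [← Metric.cobounded_eq_cocompact, ← tendsto_norm_atTop_iff_cobounded]
    simp only [norm_div, norm_neg]
    exact tendsto_norm_cobounded_atTop.atTop_div_const (by simp [Real.pi_pos.ne'])
  refine ((Real.tendsto_integral_exp_smul_cocompact fun t => f (z, t)).comp hscale).congr
    fun lam => ?_
  refine integral_congr_ae (Eventually.of_forall fun t => ?_)
  simp only [Circle.smul_def, Real.fourierChar_apply, smul_eq_mul]
  congr 2
  have hpi : (π : ℂ) ≠ 0 := by exact_mod_cast Real.pi_ne_zero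
  push_cast
  field_simp

/-- The Riemann–Lebesgue lemma for the partial Fourier transform, in `L¹(ℂⁿ)`. -/
lemma tendsto_integral_norm_fLam (hf : Integrable f) :
    Tendsto (fun lam : ℝ => ∫ w : Cn n, ‖fLam n f lam w‖) (Bornology.cobounded ℝ) (nhds 0) := by
  have : (Bornology.cobounded ℝ).IsCountablyGenerated := by
    rw [← comap_norm_atTop]; infer_instance
  rw [← integral_zero (Cn n) ℝ (μ := volume)]
  refine tendsto_integral_filter_of_dominated_convergence (fun z => ∫ t : ℝ, ‖f (z, t)‖)
    (Eventually.of_forall fun lam => (integrable_fLam hf lam).norm.aestronglyMeasurable)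
    (Eventually.of_forall fun lam => Eventually.of_forall fun z => ?_)
    hf.norm.integral_prod_left
    (Eventually.of_forall fun z => ?_)
  · simpa using norm_fLam_le_s19 lam z
  · simpa using (tendsto_fLam_cobounded (f := f) z).norm

lemma norm_normC_mul_stri_le (hn : 1 ≤ n) (hf : Integrable f) (k : ℕ) (lam : ℝ) (z : Cn n) :
    ‖((normC n k : ℝ) : ℂ) * stri n f k lam z‖ ≤ ∫ w : Cn n, ‖fLam n f (-lam) w‖ := by
  rw [stri, twConv, ← integral_const_mul,
    ← integral_sub_left_eq_self (fun w => ‖fLam n f (-lam) w‖) volume z]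
  refine norm_integral_le_of_norm_le ((integrable_fLam hf (-lam)).norm.comp_sub_left z)
    (Eventually.of_forall fun w => ?_)
  have hphase : ‖Complex.exp (Complex.I / 2 * ((-lam : ℝ) : ℂ) * ((imZW z w : ℝ) : ℂ))‖ = 1 := by
    rw [show Complex.I / 2 * ((-lam : ℝ) : ℂ) * ((imZW z w : ℝ) : ℂ) =
      Complex.I * ((-lam / 2 : ℝ) : ℂ) * ((imZW z w : ℝ) : ℂ) by push_cast; ring]
    exact norm_exp_I_mul_mul _ _
  rw [norm_mul, norm_mul, norm_mul, hphase, Complex.norm_real, Complex.norm_real,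
    Real.norm_eq_abs, Real.norm_eq_abs, abs_of_nonneg (normC_nonneg n k), mul_one]
  calc normC n k * (‖fLam n f (-lam) (z - w)‖ * |lagFun n k lam w|)
      = ‖fLam n f (-lam) (z - w)‖ * (normC n k * |lagFun n k lam w|) := by ring
    _ ≤ ‖fLam n f (-lam) (z - w)‖ * 1 := by
        gcongr
        exact normC_mul_abs_lagFun_le hn k lam w
    _ = ‖fLam n f (-lam) (z - w)‖ := mul_one _

end Fibre

/-- The normalized Strichartz Fourier transform is bounded by the L¹ norm of f^{−λ} in z,
uniformly in k and z; consequently it tends to 0 as |λ| → ∞, uniformly in k and z. -/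
theorem strichartz_decay_in_lambda (n : ℕ) (hn : 1 ≤ n) (f : Hn n → ℂ)
    (hf : Integrable f (volume : Measure (Hn n))) :
    (∀ lam : ℝ, lam ≠ 0 → ∀ (k : ℕ) (z : Cn n),
      ‖((normC n k : ℝ) : ℂ) * stri n f k lam z‖ ≤ ∫ w : Cn n, ‖fLam n f (-lam) w‖) ∧
    (∀ ε : ℝ, 0 < ε → ∃ R : ℝ, ∀ lam : ℝ, lam ≠ 0 → R < |lam| →
      ∀ (k : ℕ) (z : Cn n),
        ‖((normC n k : ℝ) : ℂ) * stri n f k lam z‖ < ε) := by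
  refine ⟨fun lam _ k z => norm_normC_mul_stri_le hn hf k lam z, fun ε hε => ?_⟩
  have h := (tendsto_integral_norm_fLam hf).eventually (gt_mem_nhds hε)
  rw [← comap_norm_atTop, eventually_comap] at h
  obtain ⟨R, hR⟩ := eventually_atTop.1 h
  refine ⟨R, fun lam _ hlam k z => ?_⟩
  exact (norm_normC_mul_stri_le hn hf k lam z).trans_lt
    (hR |lam| hlam.le (-lam) (by rw [norm_neg, Real.norm_eq_abs]))
end
end
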